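/- arXiv:2407.11423 — 12 statements merged into one kernel-verified Lean document; each statement's English description precedes it below -/
import Mathlib

section
/- Let d ≥ 1 be an integer and for x ∈ ℝ^d define p_{HS,d}(x) = ∫_0^∞ (2πλ²)^{-d/2} exp(-‖x‖²/(2λ²)) · (2/(π(1+λ²))) dλ. Then for every x ∈ ℝ^d with x ≠ 0, p_{HS,d}(x) = (Γ((d+1)/2)/√(2π^{d+2})) · exp(‖x‖²/2) · E_{(d+1)/2}(‖x‖²/2) / ‖x‖^{d-1}. -/
open MeasureTheory Real

/-- The Grouped Horseshoe density on `ℝ^d`. -/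
noncomputable def pHS (d : ℕ) (x : EuclideanSpace ℝ (Fin d)) : ℝ :=
  ∫ l in Set.Ioi (0:ℝ),
    (2 * π * l ^ 2) ^ (-(d:ℝ)/2) * Real.exp (-‖x‖^2 / (2 * l ^ 2)) *
      (2 / (π * (1 + l ^ 2)))

/-- The generalized exponential integral `E_ν(x) = ∫_1^∞ exp(-x t) t^{-ν} dt`. -/
noncomputable def genExpInt (ν x : ℝ) : ℝ :=
  ∫ t in Set.Ioi (1:ℝ), Real.exp (-x * t) / t ^ ν

lemma hs_aux (s a : ℝ) (hs : 0 < s) (ha : 0 < a) :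
    ∫ u in Set.Ioi (0:ℝ), u ^ (s - 1) * Real.exp (-(a * u)) / (1 + u) =
      Real.Gamma s * Real.exp a * a ^ (1 - s) * genExpInt s a := by
  have hG : ∀ t : ℝ, 1 < t → ∫ u in Set.Ioi (0:ℝ), u ^ (s - 1) * Real.exp (-(a * t * u)) =
      (1 / (a * t)) ^ s * Real.Gamma s := fun t ht =>
    Real.integral_rpow_mul_exp_neg_mul_Ioi hs (by positivity)
  have hGi : ∀ t : ℝ, 1 < t → IntegrableOn (fun u : ℝ => u ^ (s - 1) * Real.exp (-(a * t * u))) (Set.Ioi 0) := by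
    intro t ht
    have := integrableOn_rpow_mul_exp_neg_mul_rpow (p := 1) (s := s - 1) (b := a * t) (by linarith) one_pos (by positivity)
    simpa using this
  have hE : IntegrableOn (fun t : ℝ => Real.exp (-a * t)) (Set.Ioi 1) :=
    integrableOn_exp_mul_Ioi (by linarith) 1
  have hrw : ∀ t : ℝ, 1 < t → (1 / (a * t)) ^ s = a ^ (-s) / t ^ s := by
    intro t ht
    have : (0:ℝ) < t := by linarith
    rw [Real.div_rpow (by norm_num) (by positivity), Real.mul_rpow ha.le this.le, Real.rpow_neg ha.le,
      Real.one_rpow]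
    field_simp
  have hint : Integrable (Function.uncurry fun (t u : ℝ) => Real.exp (-a * t) * (u ^ (s - 1) * Real.exp (-(a * t * u))))
      ((volume.restrict (Set.Ioi 1)).prod (volume.restrict (Set.Ioi 0))) := by
    rw [integrable_prod_iff]
    · constructor
      · filter_upwards [ae_restrict_mem measurableSet_Ioi] with t ht
        exact (hGi t ht).const_mul (Real.exp (-a * t))
      · have : Integrable (fun t : ℝ => Real.exp (-a * t) * ((1 / (a * t)) ^ s * Real.Gamma s)) (volume.restrict (Set.Ioi 1)) := by
          refine Integrable.mono' (hE.mul_const (a ^ (-s) * Real.Gamma s)) (by fun_prop) ?_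
          filter_upwards [ae_restrict_mem measurableSet_Ioi] with t ht
          have ht : 1 < t := ht
          have h1 : 1 ≤ t ^ s := Real.one_le_rpow ht.le hs.le
          have hg := Real.Gamma_pos_of_pos hs
          have h3 : 0 < a ^ (-s) := by positivity
          rw [hrw t ht, Real.norm_of_nonneg (by positivity)]
          gcongr
          exact div_le_self h3.le h1
        refine this.congr ?_
        filter_upwards [ae_restrict_mem measurableSet_Ioi] with t ht
        rw [← hG t ht, ← integral_const_mul]
        refine setIntegral_congr_fun measurableSet_Ioi fun u hu => ?_
        have hu : 0 < u := hu
        simp only [Function.uncurry]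
        rw [Real.norm_of_nonneg (by positivity)]
    · apply Measurable.aestronglyMeasurable
      unfold Function.uncurry
      fun_prop
  have hswap := integral_integral_swap hint
  have hL : ∫ t in Set.Ioi (1:ℝ), ∫ u in Set.Ioi (0:ℝ), Real.exp (-a * t) * (u ^ (s - 1) * Real.exp (-(a * t * u)))
      = Real.Gamma s * a ^ (-s) * genExpInt s a := by
    unfold genExpInt
    rw [← integral_const_mul]
    refine setIntegral_congr_fun measurableSet_Ioi fun t ht => ?_
    have ht : 1 < t := ht
    rw [integral_const_mul, hG t ht, hrw t ht]
    ring
  have hR : ∫ u in Set.Ioi (0:ℝ), ∫ t in Set.Ioi (1:ℝ), Real.exp (-a * t) * (u ^ (s - 1) * Real.exp (-(a * t * u)))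
      = Real.exp (-a) / a * ∫ u in Set.Ioi (0:ℝ), u ^ (s - 1) * Real.exp (-(a * u)) / (1 + u) := by
    rw [← integral_const_mul]
    refine setIntegral_congr_fun measurableSet_Ioi fun u hu => ?_
    have hu : 0 < u := hu
    have h1 : ∀ t : ℝ, Real.exp (-a * t) * (u ^ (s - 1) * Real.exp (-(a * t * u))) =
        u ^ (s - 1) * Real.exp ((-(a * (1 + u))) * t) := by
      intro t
      rw [mul_left_comm, ← Real.exp_add]
      ring_nf
    simp only [h1]
    have hneg : -(a * (1 + u)) < 0 := by
      have : 0 < a * (1 + u) := by positivity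
      linarith
    rw [integral_const_mul, integral_exp_mul_Ioi hneg]
    have : Real.exp (-(a * (1 + u)) * 1) = Real.exp (-a) * Real.exp (-(a * u)) := by
      rw [← Real.exp_add]; ring_nf
    rw [this]
    field_simp
  rw [hL, hR] at hswap
  have h1 : a ^ (1 - s) = a * a ^ (-s) := by
    rw [sub_eq_add_neg, Real.rpow_add ha, Real.rpow_one]
  have h2 : Real.exp a * Real.exp (-a) = 1 := by rw [← Real.exp_add]; simp
  rw [h1]
  set I := ∫ u in Set.Ioi (0:ℝ), u ^ (s - 1) * Real.exp (-(a * u)) / (1 + u)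
  calc I = (Real.exp a * Real.exp (-a)) * I := by rw [h2, one_mul]
    _ = Real.exp a * a * (Real.exp (-a) / a * I) := by field_simp
    _ = _ := by rw [← hswap]; ring

theorem grouped_horseshoe_density_explicit (d : ℕ) (hd : 1 ≤ d)
    (x : EuclideanSpace ℝ (Fin d)) (hx : x ≠ 0) :
    pHS d x =
      (Real.Gamma (((d:ℝ) + 1) / 2) / Real.sqrt (2 * π ^ (d + 2))) *
        Real.exp (‖x‖^2 / 2) * genExpInt (((d:ℝ) + 1) / 2) (‖x‖^2 / 2) /
          ‖x‖ ^ ((d:ℝ) - 1) := by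
  have hr : 0 < ‖x‖ := norm_pos_iff.mpr hx
  unfold pHS
  generalize ‖x‖ = r at *
  have key := hs_aux (((d:ℝ) + 1) / 2) (r ^ 2 / 2) (by positivity) (by positivity)
  rw [← integral_comp_rpow_Ioi _ (show (-2:ℝ) ≠ 0 by norm_num)] at key
  have hpi := Real.pi_pos
  have hconst : (2 * π) ^ (-(d:ℝ)/2) / π * (r ^ 2 / 2) ^ (1 - ((d:ℝ) + 1) / 2) =
      1 / Real.sqrt (2 * π ^ (d + 2)) / r ^ ((d:ℝ) - 1) := by
    rw [Real.sqrt_eq_rpow, ← Real.rpow_natCast π, ← Real.rpow_natCast r, Real.mul_rpow (by positivity) (by positivity),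
      Real.mul_rpow (by positivity) (by positivity), Real.div_rpow (by positivity) (by positivity),
      ← Real.rpow_mul hpi.le, ← Real.rpow_mul hr.le]
    have e1 : ((2:ℕ):ℝ) * (1 - ((d:ℝ) + 1) / 2) = -((d:ℝ) - 1) := by push_cast; ring
    have e2 : ((d + 2 : ℕ):ℝ) * (1 / 2) = (d:ℝ) / 2 + 1 := by push_cast; ring
    have e3 : (1 - ((d:ℝ) + 1) / 2) = -((d:ℝ)/2) + 1 / 2 := by ring
    rw [e1, e2, e3, neg_div, Real.rpow_neg hr.le, Real.rpow_add hpi, Real.rpow_add two_pos, Real.rpow_one,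
      Real.rpow_neg hpi.le]
    have := Real.rpow_pos_of_pos two_pos (-((d:ℝ)/2))
    field_simp
  have hp : ∫ l in Set.Ioi (0:ℝ),
    (2 * π * l ^ 2) ^ (-(d:ℝ)/2) * Real.exp (-r^2 / (2 * l ^ 2)) *
      (2 / (π * (1 + l ^ 2))) = (2 * π) ^ (-(d:ℝ)/2) / π * (Real.Gamma (((d:ℝ) + 1) / 2) * Real.exp (r ^ 2 / 2) *
      (r ^ 2 / 2) ^ (1 - ((d:ℝ) + 1) / 2) * genExpInt (((d:ℝ) + 1) / 2) (r ^ 2 / 2)) := by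
    rw [← key, ← integral_const_mul]
    refine setIntegral_congr_fun measurableSet_Ioi fun l hl => ?_
    have hl : 0 < l := hl
    have e1 : l ^ (-2:ℝ) = (l ^ 2)⁻¹ := by
      rw [Real.rpow_neg hl.le]; norm_num
    have e2 : (l ^ (-2:ℝ)) ^ (((d:ℝ) + 1) / 2 - 1) = l ^ (-(d:ℝ)) * l := by
      rw [← Real.rpow_mul hl.le]
      nth_rewrite 3 [← Real.rpow_one l]
      rw [← Real.rpow_add hl]; congr 1; ring
    have e3 : l ^ ((-2:ℝ) - 1) = (l ^ 3)⁻¹ := by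
      rw [show (-2:ℝ) - 1 = -(3:ℕ) by norm_num, Real.rpow_neg hl.le, Real.rpow_natCast]
    have e4 : (2 * π * l ^ 2) ^ (-(d:ℝ)/2) = (2 * π) ^ (-(d:ℝ)/2) * l ^ (-(d:ℝ)) := by
      rw [Real.mul_rpow (by positivity) (by positivity), ← Real.rpow_natCast l, ← Real.rpow_mul hl.le]
      congr 2; push_cast; ring
    have e5 : -r^2 / (2 * l ^ 2) = -(r ^ 2 / 2 * (l ^ 2)⁻¹) := by field_simp
    simp only [smul_eq_mul]
    rw [e2, e3, e4, e5, e1, show |(-2:ℝ)| = 2 by norm_num]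
    have : 1 + (l ^ 2)⁻¹ = (1 + l ^ 2) / l ^ 2 := by field_simp; ring
    rw [this]
    field_simp
  rw [hp]
  calc _ = ((2 * π) ^ (-(d:ℝ)/2) / π * (r ^ 2 / 2) ^ (1 - ((d:ℝ) + 1) / 2)) * (Real.Gamma (((d:ℝ) + 1) / 2) * Real.exp (r ^ 2 / 2) * genExpInt (((d:ℝ) + 1) / 2) (r ^ 2 / 2)) := by ring
    _ = _ := by rw [hconst]; ring
end

section
/- Let d ≥ 1 be an integer and for x ∈ ℝ^d define p_{HS,d}(x) = ∫_0^∞ (2πλ²)^{-d/2} exp(-‖x‖²/(2λ²)) · (2/(π(1+λ²))) dλ. Then p_{HS,d}(x) tends to +∞ as x tends to 0 through nonzero points of ℝ^d; that is, for every M > 0 there exists δ > 0 such that 0 < ‖x‖ < δ implies p_{HS,d}(x) > M. -/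
open MeasureTheory Real

theorem hs_integrable (d : ℕ) (r : ℝ) (hr : 0 < r) :
    IntegrableOn (fun l : ℝ => (2 * π * l ^ 2) ^ (-(d:ℝ)/2) * Real.exp (-r^2 / (2 * l ^ 2)) *
      (2 / (π * (1 + l ^ 2)))) (Set.Ioi 0) := by
  have hpi := Real.pi_pos
  have hg : IntegrableOn (fun l : ℝ => ((1 + d.factorial / (π * r^2)^d) * (2/π)) * (1 + l^2)⁻¹)
      (Set.Ioi 0) := (integrable_inv_one_add_sq.const_mul _).integrableOn
  refine Integrable.mono' hg ?_ ?_
  · apply Measurable.aestronglyMeasurable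
    fun_prop
  · filter_upwards [ae_restrict_mem measurableSet_Ioi] with l hl
    have hl : 0 < l := hl
    have h0 : 0 ≤ (2 * π * l ^ 2) ^ (-(d:ℝ)/2) := by positivity
    rw [Real.norm_of_nonneg (by positivity)]
    have e1 : 2 / (π * (1 + l ^ 2)) = (2/π) * (1+l^2)⁻¹ := by field_simp
    rw [e1, mul_assoc (1 + _) (2/π)]
    apply mul_le_mul_of_nonneg_right _ (by positivity)
    obtain ⟨s, hs⟩ : ∃ s, s = (2 * π * l ^ 2)⁻¹ := ⟨_, rfl⟩
    have hs0 : 0 < s := by rw [hs]; positivity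
    have e2 : (2 * π * l ^ 2) ^ (-(d:ℝ)/2) = s ^ ((d:ℝ)/2) := by
      rw [hs, neg_div, Real.rpow_neg (by positivity), Real.inv_rpow (by positivity)]
    have e3 : -r^2 / (2 * l ^ 2) = -(π * r^2 * s) := by rw [hs]; field_simp
    rw [e2, e3]
    have h1 : s ^ ((d:ℝ)/2) ≤ 1 + s ^ d := by
      rcases le_total s 1 with h | h
      · have := Real.rpow_le_one hs0.le h (show 0 ≤ (d:ℝ)/2 by positivity)
        have : 0 ≤ s ^ d := by positivity
        linarith
      · have h2 := Real.rpow_le_rpow_of_exponent_le h (show (d:ℝ)/2 ≤ d by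
          have : (0:ℝ) ≤ d := by positivity
          linarith)
        rw [Real.rpow_natCast] at h2
        linarith
    have h3 := Real.pow_div_factorial_le_exp (π * r^2 * s) (by positivity) d
    have h4 : s ^ d * Real.exp (-(π * r^2 * s)) ≤ d.factorial / (π * r^2)^d := by
      rw [Real.exp_neg, ← div_eq_mul_inv, div_le_div_iff₀ (Real.exp_pos _) (by positivity)]
      rw [div_le_iff₀ (by positivity), mul_pow] at h3
      linarith
    have h5 : Real.exp (-(π * r^2 * s)) ≤ 1 := Real.exp_le_one_iff.2 (by
      have : 0 < π * r^2 * s := by positivity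
      linarith)
    calc _ ≤ (1 + s^d) * Real.exp (-(π * r^2 * s)) := by gcongr
      _ ≤ _ := by linarith

theorem grouped_horseshoe_pole_at_origin (d : ℕ) (hd : 1 ≤ d) :
    ∀ M > (0:ℝ), ∃ δ > (0:ℝ), ∀ x : EuclideanSpace ℝ (Fin d),
      0 < ‖x‖ → ‖x‖ < δ → M < pHS d x := by
  intro M hM
  have hpi := Real.pi_pos
  obtain ⟨C, hC⟩ : ∃ C, C = (2 * π) ^ (-(d:ℝ)/2) * Real.exp (-(1/2)) * (1/π) := ⟨_, rfl⟩
  have hC0 : 0 < C := by rw [hC]; positivity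
  refine ⟨Real.exp (-(M/C)), Real.exp_pos _, fun x hx hxd => ?_⟩
  obtain ⟨r, hr⟩ : ∃ r, r = ‖x‖ := ⟨_, rfl⟩
  unfold pHS
  rw [← hr] at hx hxd ⊢
  have hr1 : r < 1 := hxd.trans (Real.exp_lt_one_iff.2 (by
    have : 0 < M / C := by positivity
    linarith))
  have hlog : M / C < Real.log (1 / r) := by
    rw [one_div, Real.log_inv]
    have := (Real.log_lt_iff_lt_exp hx).2 hxd
    linarith
  have hint := hs_integrable d r hx
  have hsub : Set.Ioc r 1 ⊆ Set.Ioi (0:ℝ) := fun l hl => hx.trans hl.1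
  have step1 := setIntegral_mono_set hint
    (by
      filter_upwards [ae_restrict_mem measurableSet_Ioi] with l hl
      have hl : 0 < l := hl
      show 0 ≤ _
      positivity) hsub.eventuallyLE
  have hI : IntegrableOn (fun l : ℝ => C * l⁻¹) (Set.Ioc r 1) := by
    have h : IntervalIntegrable (fun l : ℝ => l⁻¹) volume r 1 := by
      apply intervalIntegrable_inv_iff.2
      right
      rw [Set.uIcc_of_le hr1.le]
      intro h
      exact absurd h.1 (not_le.2 hx)
    exact ((intervalIntegrable_iff_integrableOn_Ioc_of_le hr1.le).1 h).const_mul C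
  have step2 := setIntegral_mono_on hI (hint.mono_set hsub) measurableSet_Ioc (by
    intro l hl
    have hl0 : 0 < l := hx.trans hl.1
    have hl1 : l ≤ 1 := hl.2
    have a1 : (2 * π) ^ (-(d:ℝ)/2) * l⁻¹ ≤ (2 * π * l ^ 2) ^ (-(d:ℝ)/2) := by
      rw [Real.mul_rpow (x := 2 * π) (y := l ^ 2) (by positivity) (by positivity)]
      apply mul_le_mul_of_nonneg_left _ (by positivity)
      rw [← Real.rpow_natCast l 2, ← Real.rpow_mul hl0.le, ← Real.rpow_neg_one]
      apply Real.rpow_le_rpow_of_exponent_ge hl0 hl1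
      have : (1:ℝ) ≤ d := by exact_mod_cast hd
      push_cast
      linarith
    have a2 : Real.exp (-(1/2)) ≤ Real.exp (-r^2 / (2 * l ^ 2)) := by
      apply Real.exp_le_exp.2
      rw [neg_div, neg_le_neg_iff, div_le_div_iff₀ (by positivity) (by norm_num)]
      have : r^2 ≤ l^2 := pow_le_pow_left₀ hx.le hl.1.le 2
      linarith
    have a3 : 1 / π ≤ 2 / (π * (1 + l ^ 2)) := by
      rw [div_le_div_iff₀ hpi (by positivity)]
      have : l^2 ≤ 1 := pow_le_one₀ hl0.le hl1
      nlinarith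
    calc C * l⁻¹ = ((2 * π) ^ (-(d:ℝ)/2) * l⁻¹) * Real.exp (-(1/2)) * (1/π) := by rw [hC]; ring
      _ ≤ _ := by gcongr)
  have hval : ∫ l in Set.Ioc r 1, C * l⁻¹ = C * Real.log (1 / r) := by
    rw [integral_const_mul, ← intervalIntegral.integral_of_le hr1.le,
      integral_inv_of_pos hx one_pos]
  rw [hval] at step2
  rw [div_lt_iff₀ hC0] at hlog
  linarith
end

section
/- Let d ≥ 1 be an integer and τ > 0. For every y ∈ ℝ^d, ∫_0^∞ ∫_{ℝ^d} (2π)^{-d/2} exp(-‖y-θ‖²/2) · (2πλ²τ²)^{-d/2} exp(-‖θ‖²/(2λ²τ²)) · (2/(π(1+λ²))) dθ dλ = (2^{d-2} π^{d+2})^{-1/2} · 𝒞(‖y‖²/2, τ²). -/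
open MeasureTheory Real

/-- `𝒞(a,b) = ∫_0^∞ exp(-a/(1+λ²b)) (1+λ²b)^{-d/2} (1+λ²)^{-1} dλ`. -/
noncomputable def Cfun (d : ℕ) (a b : ℝ) : ℝ :=
  ∫ l in Set.Ioi (0:ℝ),
    Real.exp (-a / (1 + l ^ 2 * b)) * (1 + l ^ 2 * b) ^ (-(d:ℝ)/2) * (1 + l ^ 2)⁻¹

lemma inner_aux (d : ℕ) (s : ℝ) (hs : 0 < s) (y : EuclideanSpace ℝ (Fin d)) :
    ∫ θ : EuclideanSpace ℝ (Fin d), Real.exp (-‖y - θ‖^2 / 2) * Real.exp (-‖θ‖^2 / (2 * s))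
      = Real.exp (-(‖y‖^2/2) / (1 + s)) * (2 * π * s / (1 + s)) ^ ((d:ℝ)/2) := by
  have hb : 0 < (1 + s) / (2 * s) := by positivity
  have key : ∀ θ : EuclideanSpace ℝ (Fin d),
      Real.exp (-‖y - θ‖^2 / 2) * Real.exp (-‖θ‖^2 / (2 * s)) =
      Real.exp (-(‖y‖^2/2) / (1 + s)) *
        Real.exp (-((1 + s) / (2 * s)) * ‖θ - (s / (1 + s)) • y‖ ^ 2) := by
    intro θ
    rw [← Real.exp_add, ← Real.exp_add]
    congr 1
    rw [norm_sub_sq_real, norm_sub_sq_real, norm_smul, real_inner_smul_right, mul_pow,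
      Real.norm_eq_abs, sq_abs, real_inner_comm]
    have : 1 + s ≠ 0 := by positivity
    field_simp
    ring
  simp_rw [key]
  rw [integral_const_mul, integral_sub_right_eq_self
    (fun θ : EuclideanSpace ℝ (Fin d) => Real.exp (-((1 + s) / (2 * s)) * ‖θ‖ ^ 2)),
    GaussianFourier.integral_rexp_neg_mul_sq_norm hb]
  have : π / ((1 + s) / (2 * s)) = 2 * π * s / (1 + s) := by
    field_simp
  rw [this]
  simp

lemma const_aux (d : ℕ) : ((2:ℝ) ^ ((d:ℝ) - 2) * π ^ ((d:ℝ) + 2)) ^ (-(1:ℝ)/2)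
    = (2 * π) ^ (-(d:ℝ)/2) * (2 / π) := by
  have hp := Real.pi_pos
  rw [Real.mul_rpow (by positivity) (by positivity), Real.mul_rpow (by positivity) (by positivity),
    ← Real.rpow_mul (by positivity), ← Real.rpow_mul (by positivity),
    show ((d:ℝ) - 2) * (-1/2) = -(d:ℝ)/2 + 1 by ring,
    show ((d:ℝ) + 2) * (-1/2) = -(d:ℝ)/2 - 1 by ring,
    Real.rpow_add (by positivity), Real.rpow_sub (by positivity), Real.rpow_one, Real.rpow_one]
  ring

theorem marginal_density_Cfun (d : ℕ) (hd : 1 ≤ d) (τ : ℝ) (hτ : 0 < τ)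
    (y : EuclideanSpace ℝ (Fin d)) :
    (∫ l in Set.Ioi (0:ℝ), ∫ θ : EuclideanSpace ℝ (Fin d),
        (2 * π) ^ (-(d:ℝ)/2) * Real.exp (-‖y - θ‖^2 / 2) *
          ((2 * π * l ^ 2 * τ ^ 2) ^ (-(d:ℝ)/2) *
            Real.exp (-‖θ‖^2 / (2 * l ^ 2 * τ ^ 2))) *
          (2 / (π * (1 + l ^ 2))))
      = ((2:ℝ) ^ ((d:ℝ) - 2) * π ^ ((d:ℝ) + 2)) ^ (-(1:ℝ)/2) *
          Cfun d (‖y‖^2 / 2) (τ ^ 2) := by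
  rw [const_aux, Cfun, ← integral_const_mul]
  apply setIntegral_congr_fun measurableSet_Ioi
  intro l hl
  have hl : 0 < l := hl
  have hp := Real.pi_pos
  have hs : 0 < l ^ 2 * τ ^ 2 := by positivity
  have h1 : ∀ θ : EuclideanSpace ℝ (Fin d),
      (2 * π) ^ (-(d:ℝ)/2) * Real.exp (-‖y - θ‖^2 / 2) *
          ((2 * π * l ^ 2 * τ ^ 2) ^ (-(d:ℝ)/2) *
            Real.exp (-‖θ‖^2 / (2 * l ^ 2 * τ ^ 2))) *
          (2 / (π * (1 + l ^ 2))) =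
      ((2 * π) ^ (-(d:ℝ)/2) * (2 * π * (l ^ 2 * τ ^ 2)) ^ (-(d:ℝ)/2) * (2 / (π * (1 + l ^ 2)))) *
      (Real.exp (-‖y - θ‖^2 / 2) * Real.exp (-‖θ‖^2 / (2 * (l ^ 2 * τ ^ 2)))) := by
    intro θ
    rw [← mul_assoc (2 * π), ← mul_assoc 2 (l ^ 2)]
    ring
  simp only [h1]
  rw [integral_const_mul, inner_aux d _ hs]
  generalize l ^ 2 * τ ^ 2 = s at hs
  have h2 : (2 * π * s) ^ (-(d:ℝ)/2) * (2 * π * s / (1 + s)) ^ ((d:ℝ)/2)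
      = (1 + s) ^ (-(d:ℝ)/2) := by
    rw [Real.div_rpow (by positivity) (by positivity), neg_div, Real.rpow_neg (by positivity),
      Real.rpow_neg (by positivity)]
    have : (2 * π * s) ^ ((d:ℝ)/2) ≠ 0 := by positivity
    field_simp
  rw [← h2]
  have : (1 + l ^ 2) ≠ 0 := by positivity
  generalize (2 * π * s) ^ (-(d:ℝ)/2) = A
  generalize (2 * π * s / (1 + s)) ^ ((d:ℝ)/2) = B
  generalize (2 * π) ^ (-(d:ℝ)/2) = C
  field_simp
end

section
/- Let d ≥ 1 be an integer and τ > 0, and define p(y) = (2^{d-2} π^{d+2})^{-1/2} · 𝒞(‖y‖²/2, τ²) for y ∈ ℝ^d. Then p is differentiable on ℝ^d and its log-gradient satisfies ∇_y log p(y) = -(𝒟(‖y‖²/2, τ²) / 𝒞(‖y‖²/2, τ²)) · y for every y ∈ ℝ^d. -/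
open MeasureTheory Real

/-- `𝒟(a,b) = ∫_0^∞ exp(-a/(1+λ²b)) (1+λ²b)^{-(d/2)-1} (1+λ²)^{-1} dλ`. -/
noncomputable def Dfun (d : ℕ) (a b : ℝ) : ℝ :=
  ∫ l in Set.Ioi (0:ℝ),
    Real.exp (-a / (1 + l ^ 2 * b)) * (1 + l ^ 2 * b) ^ (-((d:ℝ)/2) - 1) *
      (1 + l ^ 2)⁻¹

lemma aux_int (e A b : ℝ) (he : e ≤ 0) (hb : 0 < b) :
    Integrable (fun l : ℝ => Real.exp (-A / (1 + l ^ 2 * b)) * (1 + l ^ 2 * b) ^ e * (1 + l ^ 2)⁻¹)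
      (volume.restrict (Set.Ioi (0:ℝ))) := by
  have hI : Integrable (fun l : ℝ => Real.exp |A| * (1 + l ^ 2)⁻¹)
      (volume.restrict (Set.Ioi (0:ℝ))) :=
    (integrable_inv_one_add_sq.const_mul _).restrict
  refine hI.mono' (by fun_prop) (Filter.Eventually.of_forall fun l => ?_)
  have h1 : 1 ≤ 1 + l ^ 2 * b := by nlinarith [mul_nonneg (sq_nonneg l) hb.le]
  have h0 : 0 < 1 + l ^ 2 * b := by linarith
  have h2 : (1 + l ^ 2 * b) ^ e ≤ 1 := Real.rpow_le_one_of_one_le_of_nonpos h1 he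
  have h3 : Real.exp (-A / (1 + l ^ 2 * b)) ≤ Real.exp |A| := by
    apply Real.exp_le_exp.2
    rw [div_le_iff₀ h0]
    nlinarith [neg_abs_le A, abs_nonneg A]
  have h4 := Real.rpow_nonneg h0.le e
  rw [Real.norm_of_nonneg (by positivity)]
  gcongr
  calc _ ≤ Real.exp |A| * 1 := by gcongr
    _ = _ := mul_one _

lemma aux_deriv (d : ℕ) (a b : ℝ) (hb : 0 < b) :
    HasDerivAt (fun a => Cfun d a b) (-Dfun d a b) a := by
  have he : -((d:ℝ)/2) - 1 ≤ 0 := by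
    have : (0:ℝ) ≤ d := Nat.cast_nonneg d
    linarith
  have he2 : -(d:ℝ)/2 ≤ 0 := by linarith [(Nat.cast_nonneg d : (0:ℝ) ≤ d)]
  have key := (hasDerivAt_integral_of_dominated_loc_of_deriv_le
    (μ := volume.restrict (Set.Ioi (0:ℝ))) (x₀ := a) (s := Set.Ioi (a - 1))
    (F := fun a l => Real.exp (-a / (1 + l ^ 2 * b)) * (1 + l ^ 2 * b) ^ (-(d:ℝ)/2) * (1 + l ^ 2)⁻¹)
    (F' := fun a l => -(Real.exp (-a / (1 + l ^ 2 * b)) * (1 + l ^ 2 * b) ^ (-((d:ℝ)/2) - 1) *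
      (1 + l ^ 2)⁻¹))
    (bound := fun l => Real.exp (-(a-1) / (1 + l ^ 2 * b)) * (1 + l ^ 2 * b) ^ (-((d:ℝ)/2) - 1) *
      (1 + l ^ 2)⁻¹)
    (Ioi_mem_nhds (by linarith)) (Filter.Eventually.of_forall fun x => (aux_int _ x b he2 hb).1)
    (aux_int _ a b he2 hb) (aux_int _ a b he hb).neg.1 ?_ (aux_int _ (a-1) b he hb) ?_).2
  · rw [integral_neg] at key
    exact key
  · refine Filter.Eventually.of_forall fun l x hx => ?_
    have h0 : 0 < 1 + l ^ 2 * b := by positivity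
    have h4 := Real.rpow_nonneg h0.le (-((d:ℝ)/2) - 1)
    rw [norm_neg, Real.norm_of_nonneg (by positivity)]
    have : a - 1 ≤ x := le_of_lt hx
    gcongr
  · refine Filter.Eventually.of_forall fun l x hx => ?_
    have h0 : 0 < 1 + l ^ 2 * b := by positivity
    have h := ((((hasDerivAt_id x).neg.div_const (1 + l ^ 2 * b)).exp).mul_const
      ((1 + l ^ 2 * b) ^ (-(d:ℝ)/2))).mul_const ((1 + l ^ 2)⁻¹)
    refine h.congr_deriv ?_
    rw [Real.rpow_sub_one h0.ne', neg_div]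
    simp only [Pi.neg_apply, id]
    ring

lemma aux_pos (d : ℕ) (a b : ℝ) (hb : 0 < b) : 0 < Cfun d a b := by
  have he2 : -(d:ℝ)/2 ≤ 0 := by linarith [(Nat.cast_nonneg d : (0:ℝ) ≤ d)]
  have hp : ∀ l : ℝ, 0 < Real.exp (-a / (1 + l ^ 2 * b)) * (1 + l ^ 2 * b) ^ (-(d:ℝ)/2) *
      (1 + l ^ 2)⁻¹ := fun l => by
    have h0 : 0 < 1 + l ^ 2 * b := by positivity
    have := Real.rpow_pos_of_pos h0 (-(d:ℝ)/2)
    positivity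
  unfold Cfun
  rw [integral_pos_iff_support_of_nonneg (fun l => (hp l).le) (aux_int _ a b he2 hb)]
  rw [Function.support_eq_univ (fun l => (hp l).ne')]
  simp

theorem score_function_formula (d : ℕ) (hd : 1 ≤ d) (τ : ℝ) (hτ : 0 < τ) :
    letI p : EuclideanSpace ℝ (Fin d) → ℝ := fun y =>
      ((2:ℝ) ^ ((d:ℝ) - 2) * π ^ ((d:ℝ) + 2)) ^ (-(1:ℝ)/2) *
        Cfun d (‖y‖^2 / 2) (τ ^ 2)
    Differentiable ℝ p ∧
      ∀ y : EuclideanSpace ℝ (Fin d),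
        gradient (fun z => Real.log (p z)) y =
          -(Dfun d (‖y‖^2 / 2) (τ ^ 2) / Cfun d (‖y‖^2 / 2) (τ ^ 2)) • y := by
  set p : EuclideanSpace ℝ (Fin d) → ℝ := fun y =>
      ((2:ℝ) ^ ((d:ℝ) - 2) * π ^ ((d:ℝ) + 2)) ^ (-(1:ℝ)/2) *
        Cfun d (‖y‖^2 / 2) (τ ^ 2) with hpdef
  have hb : 0 < τ ^ 2 := by positivity
  have hF : ∀ y : EuclideanSpace ℝ (Fin d), HasFDerivAt
      (fun z : EuclideanSpace ℝ (Fin d) => Cfun d (‖z‖^2 / 2) (τ ^ 2))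
      ((-Dfun d (‖y‖^2 / 2) (τ ^ 2)) • innerSL ℝ y) y := fun y => by
    have h1 : HasFDerivAt (fun z : EuclideanSpace ℝ (Fin d) => ‖z‖^2 / 2) (innerSL ℝ y) y := by
      have h := ((hasStrictFDerivAt_norm_sq y).hasFDerivAt).mul_const (1/2 : ℝ)
      refine (h.congr_fderiv ?_).congr_of_eventuallyEq (Filter.Eventually.of_forall fun z => ?_)
      · ext z
        simp
      · simp only
        ring
    exact (aux_deriv d (‖y‖^2 / 2) (τ ^ 2) hb).comp_hasFDerivAt y h1
  have hc : 0 < ((2:ℝ) ^ ((d:ℝ) - 2) * π ^ ((d:ℝ) + 2)) ^ (-(1:ℝ)/2) := by positivity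
  have hp : ∀ y, HasFDerivAt p _ y := fun y => (hF y).const_mul _
  refine ⟨fun y => (hp y).differentiableAt, fun y => ?_⟩
  have hC := aux_pos d (‖y‖^2 / 2) (τ ^ 2) hb
  apply HasGradientAt.gradient
  rw [hasGradientAt_iff_hasFDerivAt]
  refine ((hp y).log (mul_pos hc hC).ne').congr_fderiv ?_
  ext z
  simp only [p, ContinuousLinearMap.smul_apply, innerSL_apply_apply, smul_eq_mul,
    InnerProductSpace.toDual_apply_apply, inner_smul_left]
  simp only [conj_trivial]
  have := hc.ne'
  have := hC.ne'
  field_simp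
end

section
/- Let d ≥ 1 be an integer and a, b > 0. Then 𝒞(a,b) = (exp(-a)/(2√b)) ∫_0^1 x^{-1/2} (1-x)^{(d+1)/2 - 1} (1 - (1 - b^{-1}) x)^{-1} e^{a x} dx. -/
open MeasureTheory Real

theorem Cfun_beta_integral_form (d : ℕ) (hd : 1 ≤ d) (a b : ℝ)
    (ha : 0 < a) (hb : 0 < b) :
    Cfun d a b =
      (Real.exp (-a) / (2 * Real.sqrt b)) *
        ∫ x in Set.Ioo (0:ℝ) 1,
          x ^ (-(1:ℝ)/2) * (1 - x) ^ (((d:ℝ) + 1) / 2 - 1) *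
            (1 - (1 - b⁻¹) * x)⁻¹ * Real.exp (a * x) := by
  have hu : ∀ l : ℝ, 0 < 1 + l ^ 2 * b := fun l => by positivity
  have himg : (fun l : ℝ => l ^ 2 * b / (1 + l ^ 2 * b)) '' Set.Ioi 0 = Set.Ioo (0:ℝ) 1 := by
    ext x
    constructor
    · rintro ⟨l, hl, rfl⟩
      have hl' : (0:ℝ) < l := hl
      refine ⟨by positivity, ?_⟩
      show l ^ 2 * b / (1 + l ^ 2 * b) < 1
      rw [div_lt_one (hu l)]
      linarith
    · rintro ⟨h0, h1⟩
      have h2 : 0 < 1 - x := by linarith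
      refine ⟨√(x / ((1 - x) * b)), Real.sqrt_pos.mpr (by positivity), ?_⟩
      show √(x / ((1 - x) * b)) ^ 2 * b / (1 + √(x / ((1 - x) * b)) ^ 2 * b) = x
      rw [Real.sq_sqrt (by positivity)]
      have h3 : x / ((1 - x) * b) * b = x / (1 - x) := by field_simp
      have h4 : 1 + x / (1 - x) = 1 / (1 - x) := by field_simp; ring
      rw [h3, h4]
      field_simp
  have hinj : Set.InjOn (fun l : ℝ => l ^ 2 * b / (1 + l ^ 2 * b)) (Set.Ioi 0) := by
    intro l hl m hm h
    have hl' : (0:ℝ) < l := hl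
    have hm' : (0:ℝ) < m := hm
    have h' : l ^ 2 * b / (1 + l ^ 2 * b) = m ^ 2 * b / (1 + m ^ 2 * b) := h
    rw [div_eq_div_iff (hu l).ne' (hu m).ne'] at h'
    have h2 : l ^ 2 = m ^ 2 := mul_right_cancel₀ hb.ne' (by linarith)
    exact (pow_left_inj₀ hl'.le hm'.le two_ne_zero).mp h2
  have hder : ∀ l ∈ Set.Ioi (0:ℝ), HasDerivWithinAt (fun l : ℝ => l ^ 2 * b / (1 + l ^ 2 * b))
      (2 * l * b / (1 + l ^ 2 * b) ^ 2) (Set.Ioi 0) l := by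
    intro l _
    have h1 : HasDerivAt (fun l : ℝ => l ^ 2 * b) (2 * l * b) l := by
      simpa using (hasDerivAt_pow 2 l).mul_const b
    have h2 := h1.div (h1.const_add 1) (hu l).ne'
    refine (h2.congr_deriv ?_).hasDerivWithinAt
    congr 1
    ring
  rw [← himg, integral_image_eq_integral_abs_deriv_smul measurableSet_Ioi hder hinj,
    ← integral_const_mul, Cfun]
  refine setIntegral_congr_fun measurableSet_Ioi ?_
  intro l hl
  have hl' : (0:ℝ) < l := hl
  have hU := hu l
  simp only [smul_eq_mul]
  have e1 : 1 - l ^ 2 * b / (1 + l ^ 2 * b) = (1 + l ^ 2 * b)⁻¹ := by field_simp; ring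
  have e2 : 1 - (1 - b⁻¹) * (l ^ 2 * b / (1 + l ^ 2 * b)) = (1 + l ^ 2) / (1 + l ^ 2 * b) := by
    field_simp; ring
  have e3 : (l ^ 2 * b / (1 + l ^ 2 * b)) ^ (-(1:ℝ)/2) = √(1 + l ^ 2 * b) / (l * √b) := by
    rw [neg_div, Real.rpow_neg (by positivity), ← Real.sqrt_eq_rpow,
      Real.sqrt_div (by positivity), Real.sqrt_mul (by positivity), Real.sqrt_sq hl'.le, inv_div]
  have e4 : ((1 + l ^ 2 * b)⁻¹) ^ (((d:ℝ) + 1) / 2 - 1)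
      = (1 + l ^ 2 * b) ^ (-(d:ℝ)/2) * √(1 + l ^ 2 * b) := by
    rw [Real.inv_rpow hU.le, ← Real.rpow_neg hU.le, Real.sqrt_eq_rpow, ← Real.rpow_add hU]
    congr 1
    ring
  have e5 : Real.exp (-a / (1 + l ^ 2 * b))
      = Real.exp (-a) * Real.exp (a * (l ^ 2 * b / (1 + l ^ 2 * b))) := by
    rw [← Real.exp_add]
    congr 1
    field_simp; ring
  rw [e1, e2, e3, e4, e5, abs_of_pos (by positivity)]
  have hs : √(1 + l ^ 2 * b) * √(1 + l ^ 2 * b) = 1 + l ^ 2 * b := Real.mul_self_sqrt hU.le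
  have hsb : √b * √b = b := Real.mul_self_sqrt hb.le
  have hb0 : 0 < √b := Real.sqrt_pos.mpr hb
  generalize Real.exp (a * (l ^ 2 * b / (1 + l ^ 2 * b))) = E
  generalize (1 + l ^ 2 * b) ^ (-(d:ℝ)/2) = P
  have key : (1 + l ^ 2)⁻¹ = 1 / (2 * √b) * (2 * l * b / (1 + l ^ 2 * b) ^ 2 *
      ((√(1 + l ^ 2 * b) * √(1 + l ^ 2 * b)) / (l * √b) * ((1 + l ^ 2) / (1 + l ^ 2 * b))⁻¹)) := by
    rw [hs]
    have : 1 / (2 * √b) * (2 * l * b / (1 + l ^ 2 * b) ^ 2 *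
      ((1 + l ^ 2 * b) / (l * √b) * ((1 + l ^ 2) / (1 + l ^ 2 * b))⁻¹))
      = b / (√b * √b) * (1 + l ^ 2)⁻¹ := by
      generalize √b = s at *
      field_simp
    rw [this, hsb, div_self hb.ne', one_mul]
  rw [key]
  ring
end

section
/- Let d ≥ 1 be an integer and a, b > 0. Then 𝒟(a,b) = (exp(-a)/(2√b)) ∫_0^1 x^{-1/2} (1-x)^{(d+3)/2 - 1} (1 - (1 - b^{-1}) x)^{-1} e^{a x} dx. -/
open MeasureTheory Real

theorem Dfun_aux_image (b : ℝ) (hb : 0 < b) :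
    (fun l : ℝ => l ^ 2 * b / (1 + l ^ 2 * b)) '' Set.Ioi 0 = Set.Ioo (0:ℝ) 1 := by
  ext x
  constructor
  · rintro ⟨l, hl, rfl⟩
    have hl : 0 < l := hl
    have : 0 < l ^ 2 * b := by positivity
    refine ⟨by positivity, ?_⟩
    show l ^ 2 * b / (1 + l ^ 2 * b) < 1
    rw [div_lt_one (by positivity)]
    linarith
  · rintro ⟨h0, h1⟩
    have h2 : 0 < 1 - x := by linarith
    have h3 : 0 < x / ((1 - x) * b) := by positivity
    refine ⟨Real.sqrt (x / ((1 - x) * b)), Real.sqrt_pos.2 h3, ?_⟩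
    show _ / _ = _
    rw [Real.sq_sqrt h3.le]
    have : x / ((1 - x) * b) * b = x / (1 - x) := by field_simp
    rw [this]
    have : 1 + x / (1 - x) = 1 / (1 - x) := by field_simp; ring
    rw [this]
    field_simp

theorem Dfun_aux_inj (b : ℝ) (hb : 0 < b) :
    Set.InjOn (fun l : ℝ => l ^ 2 * b / (1 + l ^ 2 * b)) (Set.Ioi 0) := by
  intro x hx y hy h
  have hx : 0 < x := hx
  have hy : 0 < y := hy
  have h : x ^ 2 * b / (1 + x ^ 2 * b) = y ^ 2 * b / (1 + y ^ 2 * b) := h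
  rw [div_eq_div_iff (by positivity) (by positivity)] at h
  have h2 : x ^ 2 * b = y ^ 2 * b := by linarith
  have h3 := mul_right_cancel₀ hb.ne' h2
  exact (pow_left_inj₀ hx.le hy.le two_ne_zero).1 h3

theorem Dfun_aux_deriv (b : ℝ) (hb : 0 < b) (l : ℝ) :
    HasDerivAt (fun l : ℝ => l ^ 2 * b / (1 + l ^ 2 * b))
      (2 * l * b / (1 + l ^ 2 * b) ^ 2) l := by
  have h1 : HasDerivAt (fun l : ℝ => l ^ 2 * b) (2 * l * b) l := by
    simpa using (hasDerivAt_pow 2 l).mul_const b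
  have h2 := h1.div (h1.const_add 1) (by positivity)
  refine h2.congr_deriv ?_
  congr 1
  ring

theorem Dfun_beta_integral_form (d : ℕ) (hd : 1 ≤ d) (a b : ℝ)
    (ha : 0 < a) (hb : 0 < b) :
    Dfun d a b =
      (Real.exp (-a) / (2 * Real.sqrt b)) *
        ∫ x in Set.Ioo (0:ℝ) 1,
          x ^ (-(1:ℝ)/2) * (1 - x) ^ (((d:ℝ) + 3) / 2 - 1) *
            (1 - (1 - b⁻¹) * x)⁻¹ * Real.exp (a * x) := by
  rw [← Dfun_aux_image b hb, integral_image_eq_integral_abs_deriv_smul measurableSet_Ioi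
    (fun x _ => (Dfun_aux_deriv b hb x).hasDerivWithinAt) (Dfun_aux_inj b hb),
    ← integral_const_mul, Dfun]
  refine setIntegral_congr_fun measurableSet_Ioi ?_
  intro l hl
  have hl : 0 < l := hl
  simp only [smul_eq_mul]
  have hW : 0 < 1 + l ^ 2 * b := by positivity
  rw [abs_of_pos (by positivity)]
  have e1 : 1 - l ^ 2 * b / (1 + l ^ 2 * b) = (1 + l ^ 2 * b)⁻¹ := by field_simp; ring
  have e2 : 1 - (1 - b⁻¹) * (l ^ 2 * b / (1 + l ^ 2 * b)) = (1 + l ^ 2) / (1 + l ^ 2 * b) := by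
    field_simp; ring
  have e3 : Real.exp (a * (l ^ 2 * b / (1 + l ^ 2 * b)))
      = Real.exp a * Real.exp (-a / (1 + l ^ 2 * b)) := by
    rw [← Real.exp_add]; congr 1; field_simp; ring
  have e4 : (l ^ 2 * b / (1 + l ^ 2 * b)) ^ (-(1:ℝ)/2)
      = Real.sqrt (1 + l ^ 2 * b) / (l * Real.sqrt b) := by
    rw [show (-(1:ℝ)/2) = -(1/2) by ring, Real.rpow_neg (by positivity), ← Real.sqrt_eq_rpow,
      Real.sqrt_div (by positivity), Real.sqrt_mul (by positivity), Real.sqrt_sq hl.le, inv_div]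
  have e5 : ((1 + l ^ 2 * b)⁻¹) ^ (((d:ℝ) + 3) / 2 - 1)
      = (1 + l ^ 2 * b) ^ (-((d:ℝ)/2) - 1) * Real.sqrt (1 + l ^ 2 * b) := by
    rw [Real.inv_rpow hW.le, ← Real.rpow_neg hW.le, Real.sqrt_eq_rpow, ← Real.rpow_add hW]
    congr 1; ring
  rw [e1, e2, e3, e4, e5, Real.exp_neg]
  have hs : Real.sqrt (1 + l ^ 2 * b) ^ 2 = 1 + l ^ 2 * b := Real.sq_sqrt hW.le
  have hsb : Real.sqrt b ^ 2 = b := Real.sq_sqrt hb.le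
  have hsb0 : 0 < Real.sqrt b := Real.sqrt_pos.2 hb
  have hE : Real.exp a ≠ 0 := Real.exp_ne_zero a
  generalize Real.exp (-a / (1 + l ^ 2 * b)) = E
  generalize (1 + l ^ 2 * b) ^ (-((d:ℝ)/2) - 1) = P
  generalize Real.sqrt (1 + l ^ 2 * b) = S at *
  generalize 1 + l ^ 2 * b = W at *
  have hL : 1 + l ^ 2 ≠ 0 := by positivity
  generalize 1 + l ^ 2 = L at *
  generalize Real.sqrt b = B at *
  subst hsb
  subst hs
  have : S ≠ 0 := by rintro rfl; simp at hW
  field_simp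
end

section
/- Let d ≥ 1 be an integer and b > 0 be fixed. Then lim_{a → ∞} a · 𝒟(a,b) / 𝒞(a,b) = (d+1)/2. -/
open MeasureTheory Real Filter

noncomputable def Jint (p b e v : ℝ) : ℝ :=
  Real.exp (-1 / (e + v ^ 2)) * (e + v ^ 2) ^ (-p) * (e + v ^ 2 / b)⁻¹

lemma aux_scale (p a b : ℝ) (ha : 0 < a) (hb : 0 < b) :
    (∫ l in Set.Ioi (0:ℝ),
      Real.exp (-a / (1 + l ^ 2 * b)) * (1 + l ^ 2 * b) ^ (-p) * (1 + l ^ 2)⁻¹)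
    = (√(a / b) * (a ^ (-p) * a⁻¹)) * ∫ v in Set.Ioi (0:ℝ), Jint p b a⁻¹ v := by
  have hc : 0 < √(a / b) := Real.sqrt_pos.mpr (div_pos ha hb)
  have hc2 : √(a / b) ^ 2 = a / b := Real.sq_sqrt (div_pos ha hb).le
  have h := integral_comp_mul_left_Ioi (fun l : ℝ =>
      Real.exp (-a / (1 + l ^ 2 * b)) * (1 + l ^ 2 * b) ^ (-p) * (1 + l ^ 2)⁻¹) 0 hc
  rw [mul_zero, smul_eq_mul, eq_inv_mul_iff_mul_eq₀ hc.ne'] at h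
  rw [← h, mul_assoc]
  congr 1
  rw [← integral_const_mul]
  apply integral_congr_ae
  refine Eventually.of_forall fun v => ?_
  have e1 : 1 + (√(a / b) * v) ^ 2 * b = a * (a⁻¹ + v ^ 2) := by
    rw [mul_pow, hc2]; field_simp
  have e2 : 1 + (√(a / b) * v) ^ 2 = a * (a⁻¹ + v ^ 2 / b) := by
    rw [mul_pow, hc2]; field_simp
  have hs : 0 < a⁻¹ + v ^ 2 := by positivity
  simp only [Jint]
  rw [e1, e2, Real.mul_rpow ha.le hs.le, mul_inv]
  have e3 : -a / (a * (a⁻¹ + v ^ 2)) = -1 / (a⁻¹ + v ^ 2) := by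
    rw [show -a = a * (-1) by ring, mul_div_mul_left _ _ ha.ne']
  rw [e3]; ring

lemma aux_bound (q : ℝ) (hq : 0 ≤ q) : ∃ M : ℝ, 0 ≤ M ∧ ∀ u : ℝ, 0 < u → Real.exp (-u) * u ^ q ≤ M := by
  obtain ⟨n, hn⟩ := exists_nat_ge q
  refine ⟨1 + n.factorial, by positivity, fun u hu => ?_⟩
  have h1 : u ^ q ≤ 1 + u ^ n := by
    rcases le_total u 1 with h | h
    · have := Real.rpow_le_one hu.le h hq
      have : 0 ≤ u ^ n := by positivity
      linarith
    · have := Real.rpow_le_rpow_of_exponent_le h hn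
      rw [Real.rpow_natCast] at this
      linarith
  have h2 : u ^ n ≤ n.factorial * Real.exp u := by
    have := Real.pow_div_factorial_le_exp u hu.le n
    rw [div_le_iff₀ (by positivity)] at this
    linarith
  have h3 : 1 ≤ Real.exp u := Real.one_le_exp hu.le
  rw [Real.exp_neg, inv_mul_le_iff₀ (Real.exp_pos u)]
  nlinarith

lemma aux_dom (p b : ℝ) (hp : 0 ≤ p) (hb : 0 < b) :
    ∃ M : ℝ, ∀ e : ℝ, 0 < e → ∀ v : ℝ, ‖Jint p b e v‖ ≤ M * (1 + v ^ 2)⁻¹ := by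
  obtain ⟨M1, h10, h1⟩ := aux_bound p hp
  obtain ⟨M2, h20, h2⟩ := aux_bound (p + 1) (by linarith)
  refine ⟨max 1 b * (M1 + M2), fun e he v => ?_⟩
  have hs : 0 < e + v ^ 2 := by positivity
  have hm : 0 < max 1 b := by positivity
  have h3 : (e + v ^ 2 / b)⁻¹ ≤ max 1 b * (e + v ^ 2)⁻¹ := by
    rw [← div_eq_mul_inv, inv_le_comm₀ (by positivity) (by positivity), inv_div,
      div_le_iff₀ hm, add_mul]
    have a1 : e ≤ e * max 1 b := le_mul_of_one_le_right he.le (le_max_left _ _)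
    have a2 : v ^ 2 ≤ v ^ 2 / b * max 1 b := by
      rw [div_mul_eq_mul_div, le_div_iff₀ hb]
      exact mul_le_mul_of_nonneg_left (le_max_right _ _) (sq_nonneg v)
    linarith
  have hJ : 0 ≤ Jint p b e v := by unfold Jint; positivity
  rw [Real.norm_of_nonneg hJ]
  set s := e + v ^ 2 with hsd
  have g1 := h1 s⁻¹ (by positivity)
  have g2 := h2 s⁻¹ (by positivity)
  have e1 : (-1 / s) = -s⁻¹ := by rw [neg_div, one_div]
  have e2 : s ^ (-p) = s⁻¹ ^ p := by rw [Real.rpow_neg hs.le, Real.inv_rpow hs.le]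
  rw [Real.rpow_add_one (by positivity)] at g2
  have key : Real.exp (-s⁻¹) * s⁻¹ ^ p * s⁻¹ ≤ (M1 + M2) * (1 + s)⁻¹ := by
    rw [← div_eq_mul_inv (M1 + M2), le_div_iff₀ (by positivity)]
    calc _ = Real.exp (-s⁻¹) * s⁻¹ ^ p + Real.exp (-s⁻¹) * (s⁻¹ ^ p * s⁻¹) := by
          field_simp
          ring
      _ ≤ _ := by linarith
  have k2 : (1 + s)⁻¹ ≤ (1 + v ^ 2)⁻¹ := by
    apply inv_anti₀ (by positivity); linarith
  unfold Jint
  rw [← hsd, e1, e2]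
  calc _ ≤ Real.exp (-s⁻¹) * s⁻¹ ^ p * (max 1 b * s⁻¹) := by gcongr
    _ = max 1 b * (Real.exp (-s⁻¹) * s⁻¹ ^ p * s⁻¹) := by ring
    _ ≤ max 1 b * ((M1 + M2) * (1 + s)⁻¹) := by gcongr
    _ ≤ max 1 b * ((M1 + M2) * (1 + v ^ 2)⁻¹) := by gcongr
    _ = _ := by ring

lemma aux_lim (p b : ℝ) (hp : 0 ≤ p) (hb : 0 < b) :
    Tendsto (fun a : ℝ => ∫ v in Set.Ioi (0:ℝ), Jint p b a⁻¹ v) atTop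
      (nhds (∫ v in Set.Ioi (0:ℝ), Jint p b 0 v)) := by
  obtain ⟨M, hM⟩ := aux_dom p b hp hb
  apply tendsto_integral_filter_of_dominated_convergence (fun v => M * (1 + v ^ 2)⁻¹)
  · refine Eventually.of_forall fun a => ?_
    apply Measurable.aestronglyMeasurable
    unfold Jint
    fun_prop
  · filter_upwards [eventually_gt_atTop 0] with a ha
    exact Eventually.of_forall fun v => hM _ (inv_pos.mpr ha) v
  · exact (integrable_inv_one_add_sq.const_mul M).integrableOn
  · filter_upwards [ae_restrict_mem measurableSet_Ioi] with v hv
    have hv : 0 < v := hv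
    have hc : ContinuousAt (fun e => Jint p b e v) 0 := by
      unfold Jint
      have h1 : (0:ℝ) + v ^ 2 ≠ 0 := by positivity
      have h2 : (0:ℝ) + v ^ 2 / b ≠ 0 := by positivity
      have c1 : ContinuousAt (fun e : ℝ => e + v ^ 2) 0 := by fun_prop
      have c2 : ContinuousAt (fun e : ℝ => e + v ^ 2 / b) 0 := by fun_prop
      exact (((continuousAt_const.div c1 h1).rexp).mul (c1.rpow_const (Or.inl h1))).mul
        (c2.inv₀ h2)
    exact hc.tendsto.comp tendsto_inv_atTop_zero

lemma aux_val (p b : ℝ) (hp : 0 < p + 1 / 2) :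
    (∫ v in Set.Ioi (0:ℝ), Jint p b 0 v) = b / 2 * Real.Gamma (p + 1 / 2) := by
  by_cases hb : b = 0
  · subst hb; simp [Jint]
  rw [← integral_comp_rpow_Ioi (Jint p b 0) (p := -1 / 2) (by norm_num)]
  · rw [Real.Gamma_eq_integral hp, ← integral_const_mul]
    apply setIntegral_congr_fun measurableSet_Ioi
    intro x hx
    have hx : 0 < x := hx
    have e1 : (x ^ (-1 / 2 : ℝ)) ^ 2 = x⁻¹ := by
      rw [← Real.rpow_natCast, ← Real.rpow_mul hx.le, ← Real.rpow_neg_one]; norm_num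
    simp only [Jint, e1, zero_add, smul_eq_mul]
    have e2 : x⁻¹ ^ (-p) = x ^ p := by
      rw [Real.inv_rpow hx.le, Real.rpow_neg hx.le, inv_inv]
    have e3 : x ^ (p + 1 / 2 - 1) = x ^ (-1 / 2 - 1 : ℝ) * x ^ p * x := by
      rw [← Real.rpow_add hx, ← Real.rpow_add_one hx.ne']; congr 1; ring
    have e4 : -1 / x⁻¹ = -x := by field_simp
    have e5 : |(-1 / 2 : ℝ)| = 1 / 2 := by norm_num [abs_div]
    rw [e2, e3, e4, e5]
    field_simp

theorem ratio_DC_limit (d : ℕ) (hd : 1 ≤ d) (b : ℝ) (hb : 0 < b) :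
    Tendsto (fun a : ℝ => a * Dfun d a b / Cfun d a b) atTop
      (nhds (((d:ℝ) + 1) / 2)) := by
  have hp : (0:ℝ) ≤ (d:ℝ) / 2 := by positivity
  have l1 := aux_lim ((d:ℝ) / 2) b hp hb
  have l2 := aux_lim ((d:ℝ) / 2 + 1) b (by linarith) hb
  rw [aux_val _ _ (by linarith)] at l1 l2
  have hG : 0 < Real.Gamma ((d:ℝ) / 2 + 1 / 2) := Real.Gamma_pos_of_pos (by linarith)
  have l := l2.div l1 (by positivity)
  have hv : b / 2 * Real.Gamma ((d:ℝ) / 2 + 1 + 1 / 2) / (b / 2 * Real.Gamma ((d:ℝ) / 2 + 1 / 2))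
      = ((d:ℝ) + 1) / 2 := by
    rw [show (d:ℝ) / 2 + 1 + 1 / 2 = ((d:ℝ) / 2 + 1 / 2) + 1 by ring,
      Real.Gamma_add_one (by positivity)]
    field_simp
  rw [hv] at l
  refine l.congr' ?_
  filter_upwards [eventually_gt_atTop 0] with a ha
  have hD : Dfun d a b = (√(a / b) * (a ^ (-((d:ℝ) / 2 + 1)) * a⁻¹)) *
      ∫ v in Set.Ioi (0:ℝ), Jint ((d:ℝ) / 2 + 1) b a⁻¹ v := by
    rw [← aux_scale ((d:ℝ) / 2 + 1) a b ha hb]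
    unfold Dfun
    rw [show -((d:ℝ) / 2) - 1 = -((d:ℝ) / 2 + 1) by ring]
  have hC : Cfun d a b = (√(a / b) * (a ^ (-((d:ℝ) / 2)) * a⁻¹)) *
      ∫ v in Set.Ioi (0:ℝ), Jint ((d:ℝ) / 2) b a⁻¹ v := by
    rw [← aux_scale ((d:ℝ) / 2) a b ha hb]
    unfold Cfun
    rw [neg_div]
  rw [hD, hC, neg_add, Real.rpow_add ha, Real.rpow_neg_one]
  have hc : 0 < √(a / b) := Real.sqrt_pos.mpr (div_pos ha hb)
  have hap : 0 < a ^ (-((d:ℝ) / 2)) := by positivity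
  simp only [Pi.div_apply]
  rw [← mul_div_mul_left _ _ (mul_pos hc (mul_pos hap (inv_pos.mpr ha))).ne']
  congr 1
  field_simp
end

section
/- Let d ≥ 1 be an integer and τ > 0, and define p(y) = (2^{d-2} π^{d+2})^{-1/2} · 𝒞(‖y‖²/2, τ²) for y ∈ ℝ^d. Then the score function ∇_y log p(y) tends to the zero vector as ‖y‖ → ∞; that is, for every ε > 0 there exists R > 0 such that ‖y‖ > R implies ‖∇_y log p(y)‖ < ε. -/
open MeasureTheory Real

noncomputable def Wf (d : ℕ) (b l : ℝ) : ℝ := (1 + l ^ 2 * b) ^ (-(d:ℝ)/2) * (1 + l ^ 2)⁻¹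

lemma u_ge (b : ℝ) (hb : 0 < b) (l : ℝ) : 1 ≤ 1 + l ^ 2 * b := by
  have : 0 ≤ l ^ 2 * b := by positivity
  linarith

lemma Wf_nonneg (d : ℕ) (b : ℝ) (hb : 0 < b) (l : ℝ) : 0 ≤ Wf d b l := by
  have := u_ge b hb l
  unfold Wf; positivity

lemma Wf_cont (d : ℕ) (b : ℝ) (hb : 0 < b) : Continuous (Wf d b) := by
  unfold Wf
  refine Continuous.mul ?_ ?_
  · refine Continuous.rpow_const (by fun_prop) ?_
    intro l; left; have := u_ge b hb l; positivity
  · refine Continuous.inv₀ (by fun_prop) ?_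
    intro l; positivity

lemma Wf_int (d : ℕ) (b : ℝ) (hb : 0 < b) : IntegrableOn (Wf d b) (Set.Ioi 0) := by
  refine Integrable.integrableOn (Integrable.mono' integrable_inv_one_add_sq
    (Wf_cont d b hb).aestronglyMeasurable ?_)
  refine Filter.Eventually.of_forall fun l => ?_
  rw [Real.norm_of_nonneg (Wf_nonneg d b hb l)]
  unfold Wf
  refine mul_le_of_le_one_left (by positivity) ?_
  apply Real.rpow_le_one_of_one_le_of_nonpos (u_ge b hb l)
  have : (0:ℝ) ≤ d := by positivity
  linarith

lemma expW_cont (d : ℕ) (b : ℝ) (hb : 0 < b) (a : ℝ) :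
    Continuous fun l => Real.exp (-a / (1 + l ^ 2 * b)) * Wf d b l := by
  refine Continuous.mul ?_ (Wf_cont d b hb)
  refine Real.continuous_exp.comp (Continuous.div (by fun_prop) (by fun_prop) ?_)
  intro l; have := u_ge b hb l; positivity

lemma expDW_cont (d : ℕ) (b : ℝ) (hb : 0 < b) (a : ℝ) :
    Continuous fun l => (1 + l ^ 2 * b)⁻¹ * (Real.exp (-a / (1 + l ^ 2 * b)) * Wf d b l) := by
  refine Continuous.mul ?_ (expW_cont d b hb a)
  refine Continuous.inv₀ (by fun_prop) ?_
  intro l; have := u_ge b hb l; positivity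

lemma exp_le (b : ℝ) (hb : 0 < b) (a : ℝ) (ha : 0 ≤ a) (l : ℝ) :
    Real.exp (-a / (1 + l ^ 2 * b)) ≤ 1 := by
  have := u_ge b hb l
  rw [Real.exp_le_one_iff, neg_div, neg_nonpos]; positivity

lemma expW_int (d : ℕ) (b : ℝ) (hb : 0 < b) (a : ℝ) (ha : 0 ≤ a) :
    IntegrableOn (fun l => Real.exp (-a / (1 + l ^ 2 * b)) * Wf d b l) (Set.Ioi 0) := by
  refine Integrable.mono' (Wf_int d b hb) (expW_cont d b hb a).aestronglyMeasurable ?_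
  refine Filter.Eventually.of_forall fun l => ?_
  have hW := Wf_nonneg d b hb l
  rw [Real.norm_of_nonneg (by positivity)]
  exact mul_le_of_le_one_left hW (exp_le b hb a ha l)

lemma Dbound (d : ℕ) (b : ℝ) (hb : 0 < b) (a : ℝ) (ha : 0 ≤ a) (l : ℝ) :
    (1 + l ^ 2 * b)⁻¹ * (Real.exp (-a / (1 + l ^ 2 * b)) * Wf d b l) ≤ Wf d b l := by
  have hW := Wf_nonneg d b hb l
  have h1 : Real.exp (-a / (1 + l ^ 2 * b)) * Wf d b l ≤ Wf d b l :=
    mul_le_of_le_one_left hW (exp_le b hb a ha l)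
  exact (mul_le_of_le_one_left (by positivity) (inv_le_one_of_one_le₀ (u_ge b hb l))).trans h1

noncomputable def Df (d : ℕ) (a b : ℝ) : ℝ :=
  ∫ l in Set.Ioi (0:ℝ), (1 + l ^ 2 * b)⁻¹ * (Real.exp (-a / (1 + l ^ 2 * b)) * Wf d b l)

lemma Cfun_eq (d : ℕ) (a b : ℝ) :
    Cfun d a b = ∫ l in Set.Ioi (0:ℝ), Real.exp (-a / (1 + l ^ 2 * b)) * Wf d b l := by
  unfold Cfun Wf
  congr 1; ext l; ring

lemma expDW_int (d : ℕ) (b : ℝ) (hb : 0 < b) (a : ℝ) (ha : 0 ≤ a) :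
    IntegrableOn (fun l => (1 + l ^ 2 * b)⁻¹ * (Real.exp (-a / (1 + l ^ 2 * b)) * Wf d b l))
      (Set.Ioi 0) := by
  refine Integrable.mono' (Wf_int d b hb) (expDW_cont d b hb a).aestronglyMeasurable ?_
  refine Filter.Eventually.of_forall fun l => ?_
  have hW := Wf_nonneg d b hb l
  have := u_ge b hb l
  rw [Real.norm_of_nonneg (by positivity)]
  exact Dbound d b hb a ha l

lemma C_deriv (d : ℕ) (b : ℝ) (hb : 0 < b) (a : ℝ) (ha : 0 < a) :
    HasDerivAt (fun a => Cfun d a b) (-Df d a b) a := by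
  have key := hasDerivAt_integral_of_dominated_loc_of_deriv_le
    (μ := volume.restrict (Set.Ioi (0:ℝ))) (s := Set.Ioi 0) (x₀ := a)
    (F := fun a l => Real.exp (-a / (1 + l ^ 2 * b)) * Wf d b l)
    (F' := fun a l => -((1 + l ^ 2 * b)⁻¹ * (Real.exp (-a / (1 + l ^ 2 * b)) * Wf d b l)))
    (bound := Wf d b) (Ioi_mem_nhds ha)
    (Filter.Eventually.of_forall fun x => (expW_cont d b hb x).aestronglyMeasurable)
    (expW_int d b hb a ha.le) (expDW_cont d b hb a).neg.aestronglyMeasurable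
    (Filter.Eventually.of_forall fun l x hx => ?_)
    (Wf_int d b hb)
    (Filter.Eventually.of_forall fun l x hx => ?_)
  · have h := key.2
    rw [integral_neg] at h
    simp only [Cfun_eq]
    exact h
  · have hW := Wf_nonneg d b hb l
    have := u_ge b hb l
    rw [norm_neg, Real.norm_of_nonneg (by positivity)]
    exact Dbound d b hb x (le_of_lt hx) l
  · have h1 : HasDerivAt (fun x : ℝ => -x / (1 + l ^ 2 * b)) (-1 / (1 + l ^ 2 * b)) x :=
      (hasDerivAt_id x).neg.div_const _
    have h2 := h1.exp.mul_const (Wf d b l)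
    refine h2.congr_deriv ?_
    ring

lemma D_nonneg (d : ℕ) (b : ℝ) (hb : 0 < b) (a : ℝ) : 0 ≤ Df d a b := by
  refine integral_nonneg fun l => ?_
  have hW := Wf_nonneg d b hb l
  have := u_ge b hb l
  simp only [Pi.zero_apply]
  positivity

lemma C_lower (d : ℕ) (b : ℝ) (hb : 0 < b) (r : ℝ) (hr : 1 ≤ r) :
    Real.exp (-1 / (2 * b)) * ((((1 + 4 * b) * r ^ 2) ^ d)⁻¹ * (5 * r ^ 2)⁻¹)
      ≤ Cfun d (r ^ 2 / 2) b := by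
  rw [Cfun_eq]
  have hsub : Set.Icc r (r+1) ⊆ Set.Ioi (0:ℝ) := fun x hx => by
    have := hx.1
    simp only [Set.mem_Ioi]; linarith
  have hint := expW_int d b hb (r ^ 2 / 2) (by positivity)
  have h1 : ∫ l in Set.Icc r (r+1), Real.exp (-(r ^ 2 / 2) / (1 + l ^ 2 * b)) * Wf d b l ≤
      ∫ l in Set.Ioi (0:ℝ), Real.exp (-(r ^ 2 / 2) / (1 + l ^ 2 * b)) * Wf d b l := by
    refine setIntegral_mono_set hint (Filter.Eventually.of_forall fun l => ?_)
      (LE.le.eventuallyLE hsub)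
    have hW := Wf_nonneg d b hb l
    simp only [Pi.zero_apply]
    positivity
  refine le_trans ?_ h1
  have h2 : ∫ l in Set.Icc r (r+1), Real.exp (-1 / (2 * b)) *
      ((((1 + 4 * b) * r ^ 2) ^ d)⁻¹ * (5 * r ^ 2)⁻¹) =
      Real.exp (-1 / (2 * b)) * ((((1 + 4 * b) * r ^ 2) ^ d)⁻¹ * (5 * r ^ 2)⁻¹) := by
    rw [setIntegral_const]; simp
  rw [← h2]
  refine setIntegral_mono_on ?_ (hint.mono_set hsub) measurableSet_Icc ?_
  · exact integrableOn_const (by simp)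
  intro l hl
  have hu := u_ge b hb l
  have hl1 := hl.1
  have hl0 : 0 ≤ l := by linarith
  have hl2 : l ≤ 2 * r := by linarith [hl.2]
  have hlr : r ^ 2 ≤ l ^ 2 := by gcongr
  have hlr2 : l ^ 2 ≤ 4 * r ^ 2 := by nlinarith
  have hr2 : 1 ≤ r ^ 2 := by nlinarith
  have e1 : Real.exp (-1 / (2 * b)) ≤ Real.exp (-(r ^ 2 / 2) / (1 + l ^ 2 * b)) := by
    apply Real.exp_le_exp.2
    rw [div_le_div_iff₀ (by positivity) (by positivity)]
    nlinarith
  have e2 : (((1 + 4 * b) * r ^ 2) ^ d)⁻¹ ≤ (1 + l ^ 2 * b) ^ (-(d:ℝ)/2) := by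
    have : (1 + l ^ 2 * b) ^ (-(d:ℝ)) ≤ (1 + l ^ 2 * b) ^ (-(d:ℝ)/2) := by
      apply Real.rpow_le_rpow_of_exponent_le hu
      have : (0:ℝ) ≤ d := by positivity
      linarith
    refine le_trans ?_ this
    rw [Real.rpow_neg (by positivity), Real.rpow_natCast]
    gcongr
    nlinarith
  have e3 : (5 * r ^ 2)⁻¹ ≤ (1 + l ^ 2)⁻¹ := by
    gcongr
    nlinarith
  unfold Wf
  gcongr

lemma D_upper (d : ℕ) (b : ℝ) (hb : 0 < b) (r M : ℝ) (hr : 0 < r) (hM : 0 < M) :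
    r * Df d (r ^ 2 / 2) b ≤ M⁻¹ * Cfun d (r ^ 2 / 2) b +
      r * Real.exp (-(2 * M)⁻¹ * r) * ∫ l in Set.Ioi (0:ℝ), Wf d b l := by
  rw [Cfun_eq, Df, ← integral_const_mul, ← integral_const_mul, ← integral_const_mul,
    ← integral_add ((expW_int d b hb _ (by positivity)).const_mul _)
      ((Wf_int d b hb).const_mul _)]
  refine integral_mono ((expDW_int d b hb _ (by positivity)).const_mul _)
    (((expW_int d b hb _ (by positivity)).const_mul _).add ((Wf_int d b hb).const_mul _)) ?_
  intro l
  have hu := u_ge b hb l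
  have hW := Wf_nonneg d b hb l
  simp only
  generalize 1 + l ^ 2 * b = u at *
  have hu0 : 0 < u := by linarith
  suffices h : r * u⁻¹ * Real.exp (-(r ^ 2 / 2) / u) ≤
      M⁻¹ * Real.exp (-(r ^ 2 / 2) / u) + r * Real.exp (-(2 * M)⁻¹ * r) by
    nlinarith [mul_le_mul_of_nonneg_right h hW]
  have E := Real.exp_pos (-(r ^ 2 / 2) / u)
  have E' := Real.exp_pos (-(2 * M)⁻¹ * r)
  rcases le_total (M * r) u with h | h
  · have : r * u⁻¹ ≤ M⁻¹ := by
      rw [← div_eq_mul_inv, ← one_div, div_le_div_iff₀ hu0 hM]; linarith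
    nlinarith [mul_le_mul_of_nonneg_right this E.le, mul_pos hr E']
  · have h1 : Real.exp (-(r ^ 2 / 2) / u) ≤ Real.exp (-(2 * M)⁻¹ * r) := by
      apply Real.exp_le_exp.2
      have : (2 * M)⁻¹ * r ≤ (r ^ 2 / 2) / u := by
        rw [inv_mul_eq_div, div_le_div_iff₀ (by positivity) hu0]
        nlinarith
      rw [neg_div]; linarith
    have h2 : r * u⁻¹ ≤ r := mul_le_of_le_one_right hr.le (inv_le_one_of_one_le₀ hu)
    have h3 : r * u⁻¹ * Real.exp (-(r ^ 2 / 2) / u) ≤ r * Real.exp (-(2 * M)⁻¹ * r) := by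
      gcongr
    have : 0 ≤ M⁻¹ * Real.exp (-(r ^ 2 / 2) / u) := by positivity
    linarith

lemma C_pos (d : ℕ) (b : ℝ) (hb : 0 < b) (r : ℝ) (hr : 1 ≤ r) :
    0 < Cfun d (r ^ 2 / 2) b := lt_of_lt_of_le (by positivity) (C_lower d b hb r hr)

lemma ratio_small (d : ℕ) (b : ℝ) (hb : 0 < b) (ε : ℝ) (hε : 0 < ε) :
    ∃ R ≥ (1:ℝ), ∀ r, R < r → r * Df d (r ^ 2 / 2) b < ε * Cfun d (r ^ 2 / 2) b := by
  set M := 2 / ε with hMdef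
  have hM : 0 < M := by positivity
  set I := ∫ l in Set.Ioi (0:ℝ), Wf d b l
  have hI : 0 ≤ I := integral_nonneg fun l => Wf_nonneg d b hb l
  set K := Real.exp (-1 / (2 * b)) * (((1 + 4 * b) ^ d)⁻¹ * 5⁻¹) with hK
  have hKpos : 0 < K := by positivity
  have ht : Filter.Tendsto (fun r : ℝ => r ^ ((2 * d + 3 : ℕ) : ℝ) * Real.exp (-(2 * M)⁻¹ * r))
      Filter.atTop (nhds 0) :=
    tendsto_rpow_mul_exp_neg_mul_atTop_nhds_zero _ _ (by positivity)
  have ht2 : ∀ᶠ r : ℝ in Filter.atTop,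
      r ^ ((2 * d + 3 : ℕ) : ℝ) * Real.exp (-(2 * M)⁻¹ * r) < ε / 2 * K / (I + 1) :=
    ht.eventually_lt_const (by positivity)
  obtain ⟨R, hR⟩ := Filter.eventually_atTop.1 ht2
  refine ⟨max R 1, le_max_right _ _, fun r hr => ?_⟩
  have hr1 : 1 ≤ r := (le_max_right R 1).trans hr.le
  have hr0 : 0 < r := by linarith
  have h1 := hR r ((le_max_left R 1).trans hr.le)
  rw [Real.rpow_natCast, lt_div_iff₀ (by positivity)] at h1
  have h2 := C_lower d b hb r hr1
  have h3 := D_upper d b hb r M hr0 hM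
  have h4 : K / r ^ (2 * d + 2) ≤ Cfun d (r ^ 2 / 2) b := by
    refine le_trans (le_of_eq ?_) h2
    rw [hK, mul_pow, ← pow_mul, pow_add]
    field_simp
  have h5 : M⁻¹ = ε / 2 := by rw [hMdef]; simp
  rw [h5] at h3
  have h6 : r * Real.exp (-(2 * M)⁻¹ * r) * I < ε / 2 * (K / r ^ (2 * d + 2)) := by
    rw [← mul_div_assoc (ε / 2) K, lt_div_iff₀ (by positivity)]
    refine lt_of_le_of_lt ?_ h1
    have : r ^ (2 * d + 3) = r ^ (2 * d + 2) * r := pow_succ _ _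
    rw [this]
    have : 0 ≤ r ^ (2 * d + 2) * r * Real.exp (-(2 * M)⁻¹ * r) := by positivity
    nlinarith
  have h7 : ε / 2 * (K / r ^ (2 * d + 2)) ≤ ε / 2 * Cfun d (r ^ 2 / 2) b := by gcongr
  change _ ≤ _ + r * Real.exp (-(2 * M)⁻¹ * r) * I at h3
  linarith

theorem score_tends_to_zero (d : ℕ) (hd : 1 ≤ d) (τ : ℝ) (hτ : 0 < τ) :
    letI p : EuclideanSpace ℝ (Fin d) → ℝ := fun y =>
      ((2:ℝ) ^ ((d:ℝ) - 2) * π ^ ((d:ℝ) + 2)) ^ (-(1:ℝ)/2) *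
        Cfun d (‖y‖^2 / 2) (τ ^ 2)
    ∀ ε > (0:ℝ), ∃ R > (0:ℝ), ∀ y : EuclideanSpace ℝ (Fin d),
      R < ‖y‖ → ‖gradient (fun z => Real.log (p z)) y‖ < ε := by
  intro ε hε
  set p : EuclideanSpace ℝ (Fin d) → ℝ := fun y =>
      ((2:ℝ) ^ ((d:ℝ) - 2) * π ^ ((d:ℝ) + 2)) ^ (-(1:ℝ)/2) *
        Cfun d (‖y‖^2 / 2) (τ ^ 2) with hp
  have hb : 0 < τ ^ 2 := by positivity
  obtain ⟨R, hR1, hR⟩ := ratio_small d (τ ^ 2) hb ε hε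
  refine ⟨R, by linarith, fun y hy => ?_⟩
  have hy1 : 1 ≤ ‖y‖ := by linarith
  have hC := C_pos d (τ ^ 2) hb ‖y‖ hy1
  have hD := D_nonneg d (τ ^ 2) hb (‖y‖ ^ 2 / 2)
  have hlt := hR ‖y‖ hy
  set k := ((2:ℝ) ^ ((d:ℝ) - 2) * π ^ ((d:ℝ) + 2)) ^ (-(1:ℝ)/2) with hk
  have hkpos : 0 < k := by positivity
  have h1 := ((C_deriv d (τ ^ 2) hb (‖y‖ ^ 2 / 2) (by positivity)).const_mul k).log
    (by positivity)
  have h2 : HasFDerivAt (fun z : EuclideanSpace ℝ (Fin d) => ‖z‖ ^ 2 / 2) (innerSL ℝ y) y := by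
    have := ((hasStrictFDerivAt_norm_sq y).hasFDerivAt).mul_const (2⁻¹ : ℝ)
    simp only [div_eq_mul_inv]
    refine this.congr_fderiv ?_
    ext z
    simp
  have h3 : HasFDerivAt (fun z => Real.log (p z)) _ y :=
    HasDerivAt.comp_hasFDerivAt (f := fun z : EuclideanSpace ℝ (Fin d) => ‖z‖ ^ 2 / 2) y h1 h2
  rw [gradient, LinearIsometryEquiv.norm_map, h3.fderiv, norm_smul, innerSL_apply_norm]
  have h4 : k * -Df d (‖y‖ ^ 2 / 2) (τ ^ 2) / (k * Cfun d (‖y‖ ^ 2 / 2) (τ ^ 2)) =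
      -(Df d (‖y‖ ^ 2 / 2) (τ ^ 2) / Cfun d (‖y‖ ^ 2 / 2) (τ ^ 2)) := by
    field_simp
  rw [h4, norm_neg, Real.norm_of_nonneg (by positivity), div_mul_eq_mul_div, div_lt_iff₀ hC]
  linarith
end

section
/- Let d ≥ 1 be an integer and τ > 0, and define p(y) = (2^{d-2} π^{d+2})^{-1/2} · 𝒞(‖y‖²/2, τ²) for y ∈ ℝ^d. Then the score function satisfies ∇_y log p(y) ∼ -(d+1) y / ‖y‖² for ‖y‖ ≫ 1, in the sense that (‖y‖²/(d+1)) · ∇_y log p(y) + y tends to the zero vector as ‖y‖ → ∞. -/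
open MeasureTheory Real

noncomputable def gI (d : ℕ) (b : ℝ) (k : ℕ) (a l : ℝ) : ℝ :=
  Real.exp (-a / (1 + l ^ 2 * b)) * (1 + l ^ 2 * b) ^ (-(d:ℝ)/2 - k) * (1 + l ^ 2)⁻¹

noncomputable def gM (d : ℕ) (b : ℝ) (k : ℕ) (a : ℝ) : ℝ := ∫ l in Set.Ioi (0:ℝ), gI d b k a l

lemma gI_cont (d : ℕ) {b : ℝ} (hb : 0 < b) (k : ℕ) (a : ℝ) : Continuous (gI d b k a) := by
  have hw : ∀ l : ℝ, (1 + l ^ 2 * b) ≠ 0 := fun l => by positivity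
  have hw' : ∀ l : ℝ, (1 + l ^ 2) ≠ 0 := fun l => by positivity
  unfold gI
  refine Continuous.mul (Continuous.mul ?_ ?_) ?_
  · exact Real.continuous_exp.comp (continuous_const.div (by fun_prop) hw)
  · exact Continuous.rpow_const (by fun_prop) (fun l => Or.inl (hw l))
  · exact Continuous.inv₀ (by fun_prop) hw'

lemma gI_pos (d : ℕ) {b : ℝ} (hb : 0 < b) (k : ℕ) (a l : ℝ) : 0 < gI d b k a l := by
  unfold gI; positivity

lemma gI_le (d : ℕ) {b : ℝ} (hb : 0 < b) (k : ℕ) {a : ℝ} (ha : 0 ≤ a) (l : ℝ) :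
    gI d b k a l ≤ (1 + l ^ 2)⁻¹ := by
  unfold gI
  have h1 : Real.exp (-a / (1 + l ^ 2 * b)) ≤ 1 := by
    rw [Real.exp_le_one_iff, neg_div]
    have : 0 ≤ a / (1 + l ^ 2 * b) := by positivity
    linarith
  have h2 : (1 + l ^ 2 * b) ^ (-(d:ℝ)/2 - k) ≤ 1 := by
    apply Real.rpow_le_one_of_one_le_of_nonpos
    · have : 0 ≤ l ^ 2 * b := by positivity
      linarith
    · have : (0:ℝ) ≤ d := by positivity
      have : (0:ℝ) ≤ k := by positivity
      linarith
  have h3 : 0 < (1 + l ^ 2)⁻¹ := by positivity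
  have : Real.exp (-a / (1 + l ^ 2 * b)) * (1 + l ^ 2 * b) ^ (-(d:ℝ)/2 - k) ≤ 1 :=
    mul_le_one₀ h1 (by positivity) h2
  nlinarith

lemma gI_int (d : ℕ) {b : ℝ} (hb : 0 < b) (k : ℕ) {a : ℝ} (ha : 0 ≤ a) :
    Integrable (gI d b k a) := by
  refine integrable_inv_one_add_sq.mono' (gI_cont d hb k a).aestronglyMeasurable ?_
  filter_upwards with l
  rw [Real.norm_of_nonneg (gI_pos d hb k a l).le]
  exact gI_le d hb k ha l

lemma gI_succ (d : ℕ) {b : ℝ} (hb : 0 < b) (k : ℕ) (a l : ℝ) :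
    gI d b (k+1) a l = gI d b k a l / (1 + l ^ 2 * b) := by
  have hw : 0 < 1 + l ^ 2 * b := by positivity
  unfold gI
  push_cast
  rw [show -(d:ℝ)/2 - (k+1) = (-(d:ℝ)/2 - k) - 1 by ring, Real.rpow_sub_one hw.ne']
  ring

lemma gM_deriv (d : ℕ) {b : ℝ} (hb : 0 < b) {a : ℝ} (ha : 0 < a) :
    HasDerivAt (gM d b 0) (-gM d b 1 a) a := by
  have := (hasDerivAt_integral_of_dominated_loc_of_deriv_le
    (μ := volume.restrict (Set.Ioi (0:ℝ))) (F := fun a l => gI d b 0 a l)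
    (F' := fun a l => - gI d b 1 a l) (x₀ := a) (s := Set.Ioi 0)
    (bound := fun l => (1 + l ^ 2)⁻¹) (Ioi_mem_nhds ha) ?_ ?_ ?_ ?_ ?_ ?_).2
  · rw [integral_neg] at this
    exact this
  · filter_upwards with x
    exact (gI_cont d hb 0 x).aestronglyMeasurable
  · exact (gI_int d hb 0 ha.le).integrableOn
  · exact (gI_cont d hb 1 a).neg.aestronglyMeasurable
  · filter_upwards with l x hx
    rw [norm_neg, Real.norm_of_nonneg (gI_pos d hb 1 x l).le]
    exact gI_le d hb 1 (le_of_lt hx) l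
  · exact integrable_inv_one_add_sq.integrableOn
  · filter_upwards with l x hx
    have hw : 0 < 1 + l ^ 2 * b := by positivity
    rw [gI_succ d hb 0]
    unfold gI
    have h : HasDerivAt (fun x : ℝ => -x / (1 + l ^ 2 * b)) (-1 / (1 + l ^ 2 * b)) x :=
      ((hasDerivAt_id x).neg).div_const _
    refine ((h.exp.mul_const _).mul_const _).congr_deriv ?_
    ring

lemma gPhi_deriv (d : ℕ) {b : ℝ} (hb : 0 < b) (a l : ℝ) :
    HasDerivAt (fun l => l * gI d b 0 a l)
      (-((d + 1) * gI d b 0 a l - 2 * a * gI d b 1 a l) + (d * gI d b 1 a l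
        + 2 * (gI d b 0 a l * (1 + l ^ 2)⁻¹) - 2 * a * gI d b 2 a l)) l := by
  have hw : 0 < 1 + l ^ 2 * b := by positivity
  have hv : 0 < 1 + l ^ 2 := by positivity
  have h1 : HasDerivAt (fun l : ℝ => 1 + l ^ 2 * b) (2 * l * b) l := by
    simpa using ((hasDerivAt_pow 2 l).mul_const b).const_add 1
  have h2 : HasDerivAt (fun l : ℝ => 1 + l ^ 2) (2 * l) l := by
    simpa using (hasDerivAt_pow 2 l).const_add 1
  have h3 : HasDerivAt (fun l : ℝ => -a / (1 + l ^ 2 * b)) (a * (2 * l * b) / (1 + l ^ 2 * b) ^ 2) l := by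
    refine ((hasDerivAt_const l (-a)).div h1 hw.ne').congr_deriv ?_
    ring
  have h4 := h1.rpow_const (p := -(d:ℝ)/2 - (0:ℕ)) (Or.inl hw.ne')
  have h5 := h2.inv hv.ne'
  have h6 := (hasDerivAt_id l).mul ((h3.exp.mul h4).mul h5)
  refine h6.congr_deriv ?_
  rw [gI_succ d hb 1, gI_succ d hb 0]
  unfold gI
  simp only [Pi.mul_apply, Pi.inv_apply, id]
  rw [Real.rpow_sub_one hw.ne']
  generalize Real.exp (-a / (1 + l ^ 2 * b)) = E
  generalize (1 + l ^ 2 * b) ^ (-(d:ℝ)/2 - (0:ℕ)) = W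
  push_cast
  field_simp
  ring

lemma gIBP (d : ℕ) {b : ℝ} (hb : 0 < b) {a : ℝ} (ha : 0 ≤ a) :
    |(d + 1) * gM d b 0 a - 2 * a * gM d b 1 a| ≤
      (d + 2 * (1 + b)) * gM d b 1 a + 2 * a * gM d b 2 a := by
  have i0 := (gI_int d hb 0 ha).integrableOn (s := Set.Ioi 0)
  have i1 := (gI_int d hb 1 ha).integrableOn (s := Set.Ioi 0)
  have i2 := (gI_int d hb 2 ha).integrableOn (s := Set.Ioi 0)
  have hle : ∀ l : ℝ, gI d b 0 a l * (1 + l ^ 2)⁻¹ ≤ (1 + b) * gI d b 1 a l := by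
    intro l
    rw [gI_succ d hb 0]
    have hw : 0 < 1 + l ^ 2 * b := by positivity
    have hv : 0 < 1 + l ^ 2 := by positivity
    have := gI_pos d hb 0 a l
    have h : (1 + l ^ 2)⁻¹ ≤ (1 + b) / (1 + l ^ 2 * b) := by
      rw [inv_eq_one_div, div_le_div_iff₀ hv hw]
      nlinarith [sq_nonneg l]
    calc _ ≤ gI d b 0 a l * ((1 + b) / (1 + l ^ 2 * b)) := by gcongr
      _ = _ := by ring
  have hv0 : ∀ l : ℝ, 0 ≤ gI d b 0 a l * (1 + l ^ 2)⁻¹ := fun l =>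
    mul_nonneg (gI_pos d hb 0 a l).le (by positivity)
  have i3 : IntegrableOn (fun l => gI d b 0 a l * (1 + l ^ 2)⁻¹) (Set.Ioi 0) := by
    refine (i1.const_mul (1 + b)).mono' ?_ ?_
    · refine ((gI_cont d hb 0 a).mul (Continuous.inv₀ (by fun_prop) ?_)).aestronglyMeasurable
      intro l; positivity
    · filter_upwards with l
      rw [Real.norm_of_nonneg (hv0 l)]
      exact hle l
  have j1 := (i0.const_mul ((d:ℝ)+1)).sub (i1.const_mul (2*a))
  have j2 := ((i1.const_mul (d:ℝ)).add (i3.const_mul 2)).sub (i2.const_mul (2*a))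
  have key := integral_Ioi_of_hasDerivAt_of_tendsto (a := 0) (m := 0)
    (f := fun l => l * gI d b 0 a l)
    (continuous_id.mul (gI_cont d hb 0 a)).continuousWithinAt
    (fun l _ => gPhi_deriv d hb a l) (j1.neg.add j2) ?_
  swap
  · have hlim : Filter.Tendsto (fun l : ℝ => l⁻¹) Filter.atTop (nhds 0) := tendsto_inv_atTop_zero
    refine squeeze_zero' ?_ ?_ hlim
    · filter_upwards [Filter.eventually_gt_atTop 0] with l hl
      exact mul_nonneg hl.le (gI_pos d hb 0 a l).le
    · filter_upwards [Filter.eventually_gt_atTop 0] with l hl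
      calc l * gI d b 0 a l ≤ l * (1 + l ^ 2)⁻¹ := by
            gcongr; exact gI_le d hb 0 ha l
        _ ≤ l⁻¹ := by
            rw [← div_eq_mul_inv, inv_eq_one_div, div_le_div_iff₀ (by positivity) hl]
            nlinarith
  have e : ∫ l in Set.Ioi (0:ℝ), (-((d + 1) * gI d b 0 a l - 2 * a * gI d b 1 a l) + (d * gI d b 1 a l
        + 2 * (gI d b 0 a l * (1 + l ^ 2)⁻¹) - 2 * a * gI d b 2 a l)) =
      -((d + 1) * gM d b 0 a - 2 * a * gM d b 1 a) + (d * gM d b 1 a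
        + 2 * (∫ l in Set.Ioi (0:ℝ), gI d b 0 a l * (1 + l ^ 2)⁻¹) - 2 * a * gM d b 2 a) := by
    unfold gM
    rw [integral_add (by exact j1.neg) (by exact j2), integral_neg,
      integral_sub (i0.const_mul _) (i1.const_mul _),
      integral_sub (by exact ((i1.const_mul (d:ℝ)).add (i3.const_mul 2))) (i2.const_mul _),
      integral_add (i1.const_mul _) (i3.const_mul _)]
    simp only [integral_const_mul]
  rw [e] at key
  have b1 : (∫ l in Set.Ioi (0:ℝ), gI d b 0 a l * (1 + l ^ 2)⁻¹) ≤ (1 + b) * gM d b 1 a := by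
    unfold gM
    rw [← integral_const_mul]
    exact integral_mono i3 (i1.const_mul _) hle
  have b0 : 0 ≤ (∫ l in Set.Ioi (0:ℝ), gI d b 0 a l * (1 + l ^ 2)⁻¹) := integral_nonneg hv0
  have p1 : 0 ≤ gM d b 1 a := integral_nonneg (fun l => (gI_pos d hb 1 a l).le)
  have p2 : 0 ≤ gM d b 2 a := integral_nonneg (fun l => (gI_pos d hb 2 a l).le)
  have hd : 0 ≤ d * gM d b 1 a := by positivity
  have ha2 : 0 ≤ a * gM d b 2 a := by positivity
  simp only [zero_mul, sub_zero] at key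
  rw [abs_le]
  constructor <;> nlinarith

lemma rpow_exp_bound {m x : ℝ} (hm : 0 < m) (hx : 0 ≤ x) :
    Real.exp (-x) * x ^ m ≤ m ^ m := by
  have h : x / m ≤ Real.exp (x / m) := by linarith [Real.add_one_le_exp (x / m)]
  have h2 : (x / m) ^ m ≤ Real.exp x := by
    calc (x / m) ^ m ≤ (Real.exp (x / m)) ^ m := by
          apply Real.rpow_le_rpow (by positivity) h hm.le
      _ = Real.exp x := by rw [← Real.exp_mul]; congr 1; field_simp
  rw [Real.div_rpow hx hm.le, div_le_iff₀ (by positivity)] at h2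
  rw [Real.exp_neg, inv_mul_le_iff₀ (Real.exp_pos x)]
  exact h2

lemma gM_upper (d : ℕ) {b : ℝ} (hb : 0 < b) (k : ℕ) :
    ∃ K > 0, ∀ a > 0, gM d b k a ≤ K * a ^ (-((d:ℝ)/2 + k + 1/4)) := by
  set m : ℝ := (d:ℝ)/2 + k + 1/4 with hm
  have hm0 : 0 < m := by positivity
  have hint : Integrable (fun l : ℝ => (1 + l ^ 2) ^ (-(3/2:ℝ)/2)) := by
    have := integrable_rpow_neg_one_add_norm_sq (E := ℝ) (μ := volume) (r := 3/2)
      (by norm_num)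
    simpa using this
  set I := ∫ l in Set.Ioi (0:ℝ), (1 + l ^ 2) ^ (-(3/2:ℝ)/2) with hI
  have hI0 : 0 ≤ I := integral_nonneg (fun l => by positivity)
  refine ⟨m ^ m * (1 + b) ^ (1/4:ℝ) * I + 1, by positivity, fun a ha => ?_⟩
  have hpt : ∀ l, gI d b k a l ≤ (m ^ m * (1 + b) ^ (1/4:ℝ) * a ^ (-m)) * (1 + l ^ 2) ^ (-(3/2:ℝ)/2) := by
    intro l
    have hw : 0 < 1 + l ^ 2 * b := by positivity
    have hv : 0 < 1 + l ^ 2 := by positivity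
    have h1 := rpow_exp_bound (x := a / (1 + l ^ 2 * b)) hm0 (by positivity)
    have h2 : (1 + l ^ 2 * b) ^ (1/4:ℝ) ≤ (1 + b) ^ (1/4:ℝ) * (1 + l ^ 2) ^ (1/4:ℝ) := by
      rw [← Real.mul_rpow (by positivity) (by positivity)]
      apply Real.rpow_le_rpow (by positivity) _ (by norm_num)
      nlinarith [sq_nonneg l]
    have e1 : gI d b k a l = (Real.exp (-(a / (1 + l ^ 2 * b))) * (a / (1 + l ^ 2 * b)) ^ m)
        * a ^ (-m) * (1 + l ^ 2 * b) ^ (1/4:ℝ) * (1 + l ^ 2)⁻¹ := by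
      unfold gI
      rw [Real.div_rpow ha.le hw.le, Real.rpow_neg ha.le, neg_div,
        show -(d:ℝ)/2 - k = 1/4 - m by rw [hm]; ring, Real.rpow_sub hw]
      have := Real.rpow_pos_of_pos ha m
      field_simp
    have e2 : (1 + l ^ 2) ^ (-(3/2:ℝ)/2) = (1 + l ^ 2) ^ (1/4:ℝ) * (1 + l ^ 2)⁻¹ := by
      rw [← Real.rpow_neg_one, ← Real.rpow_add hv]; norm_num
    rw [e1, e2]
    calc _ ≤ m ^ m * a ^ (-m) * ((1 + b) ^ (1/4:ℝ) * (1 + l ^ 2) ^ (1/4:ℝ)) * (1 + l ^ 2)⁻¹ := by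
          gcongr
      _ = _ := by ring
  have hA := Real.rpow_pos_of_pos ha (-m)
  calc gM d b k a ≤ (m ^ m * (1 + b) ^ (1/4:ℝ) * a ^ (-m)) * I := by
        rw [hI, ← integral_const_mul]
        exact integral_mono (gI_int d hb k ha.le).integrableOn
          (hint.integrableOn.const_mul _) hpt
    _ ≤ _ := by nlinarith

lemma gM_lower (d : ℕ) {b : ℝ} (hb : 0 < b) :
    ∃ c > 0, ∀ a ≥ 1, c * a ^ (-((d:ℝ)/2 + 1/2)) ≤ gM d b 0 a := by
  refine ⟨Real.exp (-(1/b)) * (1 + b) ^ (-(d:ℝ)/2) * 2⁻¹ * (2:ℝ) ^ (-(d:ℝ)/2) * ((d:ℝ) + 1)⁻¹,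
    by positivity, fun a ha => ?_⟩
  have ha0 : 0 < a := by linarith
  have hs : 1 ≤ √a := Real.one_le_sqrt.mpr ha
  set C := Real.exp (-(1/b)) * (1 + b) ^ (-(d:ℝ)/2) * 2⁻¹ * (2:ℝ) ^ (-(d:ℝ)/2)
  have hd0 : (0:ℝ) ≤ d := by positivity
  have hlt : -(d:ℝ) - 2 < -1 := by linarith
  have hpt : ∀ l ∈ Set.Ioi (√a), C * l ^ (-(d:ℝ) - 2) ≤ gI d b 0 a l := by
    intro l hl
    have hl' : √a < l := hl
    have hl1 : 1 < l := by linarith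
    have hl0 : 0 < l := by linarith
    have hla : a ≤ l ^ 2 := by
      have := Real.sq_sqrt ha0.le
      nlinarith
    have hw : 0 < 1 + l ^ 2 * b := by positivity
    have hl2 : 1 ≤ l ^ 2 := by nlinarith
    have q1 : Real.exp (-(1/b)) ≤ Real.exp (-a / (1 + l ^ 2 * b)) := by
      apply Real.exp_le_exp.mpr
      rw [neg_div, neg_le_neg_iff, div_le_div_iff₀ hw hb]
      nlinarith
    have q2 : ((1 + b) * 2 * l ^ 2) ^ (-(d:ℝ)/2) ≤ (1 + l ^ 2 * b) ^ (-(d:ℝ)/2 - (0:ℕ)) := by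
      rw [Nat.cast_zero, sub_zero]
      apply Real.rpow_le_rpow_of_nonpos hw _ (by linarith)
      nlinarith
    have q3 : 2⁻¹ * (l ^ 2)⁻¹ ≤ (1 + l ^ 2)⁻¹ := by
      rw [← mul_inv]
      apply inv_anti₀ (by positivity)
      linarith
    have e : C * l ^ (-(d:ℝ) - 2) = Real.exp (-(1/b)) * ((1 + b) * 2 * l ^ 2) ^ (-(d:ℝ)/2) * (2⁻¹ * (l ^ 2)⁻¹) := by
      rw [Real.mul_rpow (by positivity) (by positivity), Real.mul_rpow (by positivity) (by positivity),
        ← Real.rpow_natCast l 2, ← Real.rpow_mul hl0.le, ← Real.rpow_neg hl0.le]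
      rw [show -(d:ℝ) - 2 = ((2:ℕ):ℝ) * (-(d:ℝ)/2) + -((2:ℕ):ℝ) by push_cast; ring, Real.rpow_add hl0]
      simp only [C]
      ring
    rw [e]
    unfold gI
    gcongr
  have i1 : IntegrableOn (fun l : ℝ => C * l ^ (-(d:ℝ) - 2)) (Set.Ioi (√a)) :=
    (integrableOn_Ioi_rpow_of_lt hlt (by linarith)).const_mul C
  have hint := gI_int d hb 0 ha0.le
  calc C * ((d:ℝ) + 1)⁻¹ * a ^ (-((d:ℝ)/2 + 1/2)) = ∫ l in Set.Ioi (√a), C * l ^ (-(d:ℝ) - 2) := by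
        rw [integral_const_mul, integral_Ioi_rpow_of_lt hlt (by linarith), Real.sqrt_eq_rpow,
          ← Real.rpow_mul ha0.le, show (1/2) * (-(d:ℝ) - 2 + 1) = -((d:ℝ)/2 + 1/2) by ring,
          show -(d:ℝ) - 2 + 1 = -((d:ℝ)+1) by ring, neg_div_neg_eq]
        ring
    _ ≤ ∫ l in Set.Ioi (√a), gI d b 0 a l :=
        setIntegral_mono_on i1 hint.integrableOn measurableSet_Ioi hpt
    _ ≤ gM d b 0 a := by
        apply setIntegral_mono_set hint.integrableOn
        · filter_upwards with l using (gI_pos d hb 0 a l).le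
        · exact (Set.Ioi_subset_Ioi (by linarith)).eventuallyLE

lemma gM_ratio (d : ℕ) {b : ℝ} (hb : 0 < b) :
    ∃ K > 0, ∀ a ≥ 1, 0 < gM d b 0 a ∧
      |(d + 1) * gM d b 0 a - 2 * a * gM d b 1 a| ≤ K * a ^ (-(3/4:ℝ)) * gM d b 0 a := by
  obtain ⟨K1, hK1, h1⟩ := gM_upper d hb 1
  obtain ⟨K2, hK2, h2⟩ := gM_upper d hb 2
  obtain ⟨c, hc, h0⟩ := gM_lower d hb
  refine ⟨((d + 2 * (1 + b)) * K1 + 2 * K2) / c, by positivity, fun a ha => ?_⟩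
  have ha0 : 0 < a := by linarith
  have h0 := h0 a ha
  have h1 := h1 a ha0
  have h2 := h2 a ha0
  have hA := Real.rpow_pos_of_pos ha0 (-((d:ℝ)/2 + 1/2))
  have hB := Real.rpow_pos_of_pos ha0 (-(3/4:ℝ))
  refine ⟨lt_of_lt_of_le (by positivity) h0, (gIBP d hb ha0.le).trans ?_⟩
  have e1 : a ^ (-((d:ℝ)/2 + (1:ℕ) + 1/4)) = a ^ (-((d:ℝ)/2 + 1/2)) * a ^ (-(3/4:ℝ)) := by
    rw [← Real.rpow_add ha0]; congr 1; push_cast; ring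
  have e2 : a * a ^ (-((d:ℝ)/2 + (2:ℕ) + 1/4)) = a ^ (-((d:ℝ)/2 + 1/2)) * a ^ (-(3/4:ℝ)) := by
    rw [← Real.rpow_add ha0]
    nth_rewrite 1 [← Real.rpow_one a]
    rw [← Real.rpow_add ha0]; congr 1; push_cast; ring
  have h2' : a * gM d b 2 a ≤ K2 * (a ^ (-((d:ℝ)/2 + 1/2)) * a ^ (-(3/4:ℝ))) := by
    rw [← e2]
    calc _ ≤ a * (K2 * a ^ (-((d:ℝ)/2 + (2:ℕ) + 1/4))) := by gcongr
      _ = _ := by ring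
  rw [e1] at h1
  have hq : (0:ℝ) ≤ d + 2 * (1 + b) := by positivity
  calc _ ≤ (d + 2 * (1 + b)) * (K1 * (a ^ (-((d:ℝ)/2 + 1/2)) * a ^ (-(3/4:ℝ))))
          + 2 * (K2 * (a ^ (-((d:ℝ)/2 + 1/2)) * a ^ (-(3/4:ℝ)))) := by
        have := mul_le_mul_of_nonneg_left h1 hq
        linarith
    _ = ((d + 2 * (1 + b)) * K1 + 2 * K2) / c * a ^ (-(3/4:ℝ)) * (c * a ^ (-((d:ℝ)/2 + 1/2))) := by
        field_simp
    _ ≤ _ := by gcongr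

theorem score_tail_asymptotics (d : ℕ) (hd : 1 ≤ d) (τ : ℝ) (hτ : 0 < τ) :
    letI p : EuclideanSpace ℝ (Fin d) → ℝ := fun y =>
      ((2:ℝ) ^ ((d:ℝ) - 2) * π ^ ((d:ℝ) + 2)) ^ (-(1:ℝ)/2) *
        Cfun d (‖y‖^2 / 2) (τ ^ 2)
    ∀ ε > (0:ℝ), ∃ R > (0:ℝ), ∀ y : EuclideanSpace ℝ (Fin d),
      R < ‖y‖ →
        ‖(‖y‖^2 / ((d:ℝ) + 1)) • gradient (fun z => Real.log (p z)) y + y‖ < ε := by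
  suffices H : ∀ p : EuclideanSpace ℝ (Fin d) → ℝ, (p = fun y =>
      ((2:ℝ) ^ ((d:ℝ) - 2) * π ^ ((d:ℝ) + 2)) ^ (-(1:ℝ)/2) *
        Cfun d (‖y‖^2 / 2) (τ ^ 2)) →
      ∀ ε > (0:ℝ), ∃ R > (0:ℝ), ∀ y : EuclideanSpace ℝ (Fin d),
      R < ‖y‖ →
        ‖(‖y‖^2 / ((d:ℝ) + 1)) • gradient (fun z => Real.log (p z)) y + y‖ < ε from H _ rfl
  intro p hp0 ε hε
  have hb : 0 < τ ^ 2 := by positivity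
  set b := τ ^ 2 with hbdef
  obtain ⟨K, hK, hr⟩ := gM_ratio d hb
  have hC : ∀ a, Cfun d a b = gM d b 0 a := by
    intro a; simp [Cfun, gM, gI]
  set c₀ : ℝ := ((2:ℝ) ^ ((d:ℝ) - 2) * π ^ ((d:ℝ) + 2)) ^ (-(1:ℝ)/2) with hc₀
  have hc₀pos : 0 < c₀ := by
    have := Real.pi_pos
    positivity
  have hp : p = fun y => c₀ * gM d b 0 (‖y‖^2/2) := by
    rw [hp0]; funext y; simp only [hC]
  have hgrad : ∀ y : EuclideanSpace ℝ (Fin d), 1 ≤ ‖y‖^2/2 →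
      gradient (fun z => Real.log (p z)) y
        = (-gM d b 1 (‖y‖^2/2) / gM d b 0 (‖y‖^2/2)) • y := by
    intro y hy
    have hpos := (hr _ hy).1
    apply HasGradientAt.gradient
    rw [hasGradientAt_iff_hasFDerivAt]
    have f1 : HasFDerivAt (fun z : EuclideanSpace ℝ (Fin d) => ‖z‖^2) (2 • (innerSL ℝ y)) y :=
      (hasStrictFDerivAt_norm_sq y).hasFDerivAt
    have f2 : HasDerivAt (fun t => Real.log (c₀ * gM d b 0 (t/2)))
        (c₀ * (-gM d b 1 (‖y‖^2/2) * (1/2)) / (c₀ * gM d b 0 (‖y‖^2/2))) (‖y‖^2) := by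
      have g1 : HasDerivAt (fun t : ℝ => t/2) (1/2) (‖y‖^2) := (hasDerivAt_id _).div_const 2
      have g2 := (gM_deriv d hb (a := ‖y‖^2/2) (by linarith)).comp (‖y‖^2) g1
      exact (g2.const_mul c₀).log (by simp only [Function.comp]; positivity)
    have f3 := f2.comp_hasFDerivAt y f1
    rw [hp]
    refine f3.congr_fderiv ?_
    ext v
    simp [inner_smul_left]
    field_simp
  have hlim : Filter.Tendsto (fun n : ℝ => K * (n^2/2) ^ (-(3/4:ℝ)) * n) Filter.atTop (nhds 0) := by
    have h1 : Filter.Tendsto (fun n : ℝ => (K * 2 ^ (3/4:ℝ)) * n ^ (-(1/2:ℝ))) Filter.atTop (nhds 0) := by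
      simpa using (tendsto_rpow_neg_atTop (by norm_num : (0:ℝ) < 1/2)).const_mul (K * 2 ^ (3/4:ℝ))
    refine h1.congr' ?_
    filter_upwards [Filter.eventually_gt_atTop 0] with n hn
    rw [Real.div_rpow (by positivity) (by norm_num), ← Real.rpow_natCast n 2, ← Real.rpow_mul hn.le,
      Real.rpow_neg (by norm_num : (0:ℝ) ≤ 2), div_inv_eq_mul,
      show -(1/2:ℝ) = ((2:ℕ):ℝ) * (-(3/4)) + 1 by norm_num, Real.rpow_add hn, Real.rpow_one]
    ring
  obtain ⟨R, hR⟩ := Filter.eventually_atTop.mp (hlim.eventually (gt_mem_nhds hε))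
  refine ⟨max R 2, by positivity, fun y hy => ?_⟩
  have hyR : R < ‖y‖ := (le_max_left _ _).trans_lt hy
  have hy2 : 2 < ‖y‖ := (le_max_right _ _).trans_lt hy
  have ha : 1 ≤ ‖y‖^2/2 := by nlinarith
  rw [hgrad y ha]
  obtain ⟨hpos, hb2⟩ := hr _ ha
  have hlt := hR _ hyR.le
  generalize gM d b 0 (‖y‖^2/2) = A at *
  generalize gM d b 1 (‖y‖^2/2) = B at *
  have hd1 : (1:ℝ) ≤ d + 1 := by
    have : (0:ℝ) ≤ d := by positivity
    linarith
  have e : (‖y‖^2 / ((d:ℝ) + 1)) • (-B / A) • y + y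
      = ((((d:ℝ) + 1) * A - 2 * (‖y‖^2/2) * B) / (((d:ℝ) + 1) * A)) • y := by
    rw [smul_smul]
    nth_rewrite 3 [← one_smul ℝ y]
    rw [← add_smul]
    congr 1
    field_simp
    ring
  rw [e, norm_smul, norm_div, Real.norm_eq_abs, Real.norm_of_nonneg (by positivity : 0 ≤ ((d:ℝ)+1) * A)]
  refine lt_of_le_of_lt ?_ hlt
  gcongr
  rw [div_le_iff₀ (by positivity)]
  refine hb2.trans ?_
  gcongr
  nlinarith
end

section
/- Let d ≥ 1 be an integer and r > 0. Then ∫_{{θ ∈ ℝ^d : ‖θ‖ ≤ r}} p_{HS,d}(θ) dθ = (Γ((d+1)/2)/(π Γ(d/2))) ∫_0^{r²/2} u^{-1/2} exp(u) E_{(d+1)/2}(u) du. -/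
open MeasureTheory Real

lemma aux_fubini (a u : ℝ) (ha : 0 < a) (hu : 0 < u) :
    ∫ x in Set.Ioi (0:ℝ), x ^ (a - 1) * (Real.exp (-(u * x)) / (1 + x))
      = Real.exp u * (Real.Gamma a * (u ^ (1 - a) * genExpInt a u)) := by
  have hG : ∀ v : ℝ, 0 < v → ∫ x in Set.Ioi (0:ℝ), x ^ (a - 1) * Real.exp (-(v * x)) * Real.exp (-v)
      = Real.Gamma a * (v ^ (-a) * Real.exp (-v)) := by
    intro v hv
    rw [integral_mul_const, Real.integral_rpow_mul_exp_neg_mul_Ioi ha hv, one_div,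
      Real.inv_rpow hv.le, Real.rpow_neg hv.le]
    ring
  have hint : Integrable (Function.uncurry
      (fun x v : ℝ => x ^ (a - 1) * Real.exp (-(v * x)) * Real.exp (-v)))
      ((volume.restrict (Set.Ioi (0:ℝ))).prod (volume.restrict (Set.Ioi u))) := by
    rw [integrable_prod_iff' (by
      apply Measurable.aestronglyMeasurable
      unfold Function.uncurry
      fun_prop)]
    constructor
    · filter_upwards [ae_restrict_mem measurableSet_Ioi] with v hv
      have hv0 : 0 < v := hu.trans hv
      have := integrableOn_rpow_mul_exp_neg_mul_rpow (p := 1) (s := a - 1) (b := v)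
        (by linarith) one_pos hv0
      simp only [Real.rpow_one, neg_mul] at this
      exact Integrable.mul_const this (Real.exp (-v))
    · have h1 : IntegrableOn (fun v : ℝ => Real.Gamma a * (v ^ (-a) * Real.exp (-v)))
          (Set.Ioi u) := by
        apply Integrable.const_mul
        refine Integrable.mono' (g := fun v => u ^ (-a) * Real.exp (-v))
          ((integrableOn_exp_neg_Ioi u).const_mul _)
          (Measurable.aestronglyMeasurable (by fun_prop)) ?_
        filter_upwards [ae_restrict_mem measurableSet_Ioi] with v hv
        have hv0 : 0 < v := hu.trans hv
        rw [Real.norm_of_nonneg (by positivity)]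
        gcongr ?_ * _
        exact Real.rpow_le_rpow_of_nonpos hu (le_of_lt hv) (by linarith)
      refine Integrable.congr h1 ?_
      filter_upwards [ae_restrict_mem measurableSet_Ioi] with v hv
      have hv0 : 0 < v := hu.trans hv
      rw [← hG v hv0]
      apply setIntegral_congr_fun measurableSet_Ioi
      intro x hx
      have hx0 : 0 < x := hx
      simp only [Function.uncurry]
      rw [Real.norm_of_nonneg (by positivity)]
  have hsw := integral_integral_swap hint
  have hL : ∫ x in Set.Ioi (0:ℝ), ∫ v in Set.Ioi u,
      x ^ (a - 1) * Real.exp (-(v * x)) * Real.exp (-v)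
      = Real.exp (-u) * ∫ x in Set.Ioi (0:ℝ), x ^ (a - 1) * (Real.exp (-(u * x)) / (1 + x)) := by
    rw [← integral_const_mul]
    apply setIntegral_congr_fun measurableSet_Ioi
    intro x hx
    have hx0 : 0 < x := hx
    have h2 : ∀ v : ℝ, x ^ (a - 1) * Real.exp (-(v * x)) * Real.exp (-v)
        = x ^ (a - 1) * Real.exp (-(1 + x) * v) := by
      intro v
      rw [mul_assoc, ← Real.exp_add]
      ring_nf
    simp only [h2]
    rw [integral_const_mul, integral_exp_mul_Ioi (by linarith)]
    have : Real.exp (-(1 + x) * u) = Real.exp (-u) * Real.exp (-(u * x)) := by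
      rw [← Real.exp_add]; ring_nf
    rw [this]
    field_simp
  have hR : ∫ v in Set.Ioi u, ∫ x in Set.Ioi (0:ℝ),
      x ^ (a - 1) * Real.exp (-(v * x)) * Real.exp (-v)
      = Real.Gamma a * (u ^ (1 - a) * genExpInt a u) := by
    have h3 : ∫ v in Set.Ioi u, ∫ x in Set.Ioi (0:ℝ),
      x ^ (a - 1) * Real.exp (-(v * x)) * Real.exp (-v)
      = ∫ v in Set.Ioi u, Real.Gamma a * (v ^ (-a) * Real.exp (-v)) :=
      setIntegral_congr_fun measurableSet_Ioi (fun v hv => hG v (hu.trans hv))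
    rw [h3, integral_const_mul]
    congr 1
    have h4 := integral_comp_mul_left_Ioi (fun v : ℝ => v ^ (-a) * Real.exp (-v)) 1 hu
    rw [mul_one, smul_eq_mul] at h4
    have h5 : ∫ v in Set.Ioi u, v ^ (-a) * Real.exp (-v)
      = u * ∫ x in Set.Ioi (1:ℝ), (u * x) ^ (-a) * Real.exp (-(u * x)) := by
      rw [h4]; field_simp
    rw [h5, genExpInt, ← integral_const_mul, ← integral_const_mul]
    apply setIntegral_congr_fun measurableSet_Ioi
    intro x hx
    have hx0 : 0 < x := one_pos.trans hx
    simp only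
    rw [Real.mul_rpow hu.le hx0.le, sub_eq_add_neg, Real.rpow_add hu, Real.rpow_one,
      Real.rpow_neg hx0.le, neg_mul]
    ring
  rw [← hR, ← hsw, hL, ← mul_assoc, ← Real.exp_add]
  simp

lemma aux_p (d : ℕ) (u : ℝ) (hu : 0 < u) :
    ∫ l in Set.Ioi (0:ℝ),
      (2 * π * l ^ 2) ^ (-(d:ℝ)/2) * Real.exp (-u / l ^ 2) * (2 / (π * (1 + l ^ 2)))
    = (2 * π) ^ (-(d:ℝ)/2) / π * (Real.exp u * (Real.Gamma (((d:ℝ) + 1) / 2) *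
        (u ^ (1 - ((d:ℝ) + 1) / 2) * genExpInt (((d:ℝ) + 1) / 2) u))) := by
  rw [← aux_fubini _ u (by positivity) hu, ← integral_comp_rpow_Ioi _ (p := -1/2) (by norm_num),
    ← integral_const_mul]
  apply setIntegral_congr_fun measurableSet_Ioi
  intro x hx
  have hx0 : 0 < x := hx
  simp only [smul_eq_mul]
  have e1 : (x ^ (-1/2 : ℝ)) ^ 2 = x⁻¹ := by
    rw [← Real.rpow_natCast, ← Real.rpow_mul hx0.le, ← Real.rpow_neg_one]
    norm_num
  rw [e1, Real.mul_rpow (by positivity) (by positivity), Real.inv_rpow hx0.le,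
    ← Real.rpow_neg hx0.le]
  have e2 : |(-1/2 : ℝ)| = 1/2 := by rw [abs_of_neg] <;> norm_num
  have e3 : x ^ (((d:ℝ) + 1) / 2 - 1) = x ^ (-1/2 - 1 : ℝ) * x ^ (-(-(d:ℝ)/2)) * x := by
    nth_rewrite 4 [← Real.rpow_one x]
    rw [← Real.rpow_add hx0, ← Real.rpow_add hx0]
    ring_nf
  have e4 : -u / x⁻¹ = -(u * x) := by field_simp
  rw [e2, e3, e4]
  have : x + 1 ≠ 0 := by positivity
  field_simp
  ring

theorem ball_mass_radial_form (d : ℕ) (hd : 1 ≤ d) (r : ℝ) (hr : 0 < r) :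
    ∫ θ in Metric.closedBall (0 : EuclideanSpace ℝ (Fin d)) r, pHS d θ
      = (Real.Gamma (((d:ℝ) + 1) / 2) / (π * Real.Gamma ((d:ℝ) / 2))) *
          ∫ u in (0:ℝ)..(r^2 / 2),
            u ^ (-(1:ℝ)/2) * Real.exp u * genExpInt (((d:ℝ) + 1) / 2) u := by
  have : Nonempty (Fin d) := ⟨⟨0, hd⟩⟩
  have hd0 : (0:ℝ) < d := by exact_mod_cast hd
  set g : ℝ → ℝ := fun y => ∫ l in Set.Ioi (0:ℝ),
      (2 * π * l ^ 2) ^ (-(d:ℝ)/2) * Real.exp (-(y^2/2) / l ^ 2) * (2 / (π * (1 + l ^ 2)))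
    with hg
  have hp : ∀ θ : EuclideanSpace ℝ (Fin d), pHS d θ = g ‖θ‖ := by
    intro θ
    simp only [pHS, hg]
    congr 1
    ext l
    congr 3
    rw [← neg_div, div_div]
  set h : ℝ → ℝ := fun u => u ^ (-(1:ℝ)/2) * Real.exp u * genExpInt (((d:ℝ) + 1) / 2) u with hh
  set F : ℝ → ℝ := (Set.Iic (r^2/2)).indicator h with hF
  have hR : ∫ u in (0:ℝ)..(r^2 / 2), h u = ∫ x in Set.Ioi (0:ℝ), x * F (x^2/2) := by
    rw [intervalIntegral.integral_of_le (by positivity)]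
    have h1 : ∫ u in Set.Ioc 0 (r^2/2), h u = ∫ u in Set.Ioi (0:ℝ), F u := by
      rw [hF, setIntegral_indicator measurableSet_Iic, Set.Ioi_inter_Iic]
    have h2 := integral_comp_mul_left_Ioi F 0 (b := 1/2) (by norm_num)
    have h3 := integral_comp_rpow_Ioi (fun w => F (1/2 * w)) (p := 2) (by norm_num)
    rw [h2] at h3
    have h4 : ∫ x in Set.Ioi (0:ℝ), (|(2:ℝ)| * x ^ ((2:ℝ) - 1)) • F (1/2 * x ^ (2:ℝ))
        = 2 * ∫ x in Set.Ioi (0:ℝ), x * F (x^2/2) := by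
      rw [← integral_const_mul]
      apply setIntegral_congr_fun measurableSet_Ioi
      intro x hx
      have e : (2:ℝ) - 1 = 1 := by norm_num
      simp only [smul_eq_mul, e, Real.rpow_one, Real.rpow_two, abs_two]
      rw [mul_assoc, one_div, div_eq_inv_mul]
    rw [h4] at h3
    simp only [mul_zero, smul_eq_mul] at h3
    rw [h1]
    norm_num at h3
    exact h3.symm
  have hL : ∫ θ in Metric.closedBall (0 : EuclideanSpace ℝ (Fin d)) r, pHS d θ
      = ∫ θ : EuclideanSpace ℝ (Fin d), (Set.Iic r).indicator g ‖θ‖ := by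
    rw [← integral_indicator Metric.isClosed_closedBall.measurableSet]
    congr 1
    ext θ
    simp only [Set.indicator, Metric.mem_closedBall, dist_zero_right, Set.mem_Iic, hp]
  rw [hL, hR, integral_fun_norm_addHaar, finrank_euclideanSpace_fin, Measure.real,
    EuclideanSpace.volume_ball]
  simp only [Fintype.card_fin, ENNReal.ofReal_one, one_pow, one_mul]
  have hGp : 0 < Real.Gamma ((d:ℝ)/2 + 1) := Real.Gamma_pos_of_pos (by positivity)
  have hGp' : 0 < Real.Gamma ((d:ℝ)/2) := Real.Gamma_pos_of_pos (by positivity)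
  rw [ENNReal.toReal_ofReal (by positivity)]
  have hpt : ∫ y in Set.Ioi (0:ℝ), y ^ (d - 1) • (Set.Iic r).indicator g y
      = (2 * π) ^ (-(d:ℝ)/2) / π * Real.Gamma (((d:ℝ) + 1) / 2) * 2 ^ ((d:ℝ)/2 - 1) *
        ∫ x in Set.Ioi (0:ℝ), x * F (x^2/2) := by
    rw [← integral_const_mul]
    apply setIntegral_congr_fun measurableSet_Ioi
    intro y hy
    have hy0 : 0 < y := hy
    by_cases hyr : y ≤ r
    · have hm : y^2/2 ∈ Set.Iic (r^2/2) := by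
        simp only [Set.mem_Iic]; gcongr
      simp only [hF, smul_eq_mul]
      rw [Set.indicator_of_mem hm, Set.indicator_of_mem (by exact hyr)]
      simp only [hg, hh]
      rw [aux_p d (y^2/2) (by positivity)]
      have key : y ^ (d - 1) * (y^2/2) ^ (1 - ((d:ℝ) + 1) / 2)
          = 2 ^ ((d:ℝ)/2 - 1) * y * (y^2/2) ^ (-(1:ℝ)/2) := by
        have e0 : y ^ (d-1) = y ^ ((d:ℝ) - 1) := by
          rw [← Real.rpow_natCast, Nat.cast_sub hd, Nat.cast_one]
        have e1 : ∀ s : ℝ, (y^2/2) ^ s = y ^ (2 * s) * 2 ^ (-s) := by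
          intro s
          rw [Real.div_rpow (by positivity) (by norm_num), ← Real.rpow_two,
            ← Real.rpow_mul hy0.le, Real.rpow_neg (by norm_num), div_eq_mul_inv]
        rw [e0, e1, e1]
        have e2 : y ^ ((d:ℝ) - 1) * (y ^ (2 * (1 - ((d:ℝ) + 1) / 2)) * 2 ^ (-(1 - ((d:ℝ) + 1) / 2)))
          = 2 ^ (-(1 - ((d:ℝ) + 1) / 2)) := by
          rw [← mul_assoc, ← Real.rpow_add hy0]
          ring_nf
          simp
        have e3 : y * y ^ (2 * (-(1:ℝ)/2)) = 1 := by
          have : (2 * (-(1:ℝ)/2)) = -1 := by norm_num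
          rw [this, Real.rpow_neg_one, mul_inv_cancel₀ hy0.ne']
        have e4 : (2:ℝ) ^ (-(1 - ((d:ℝ) + 1) / 2)) = 2 ^ ((d:ℝ)/2 - 1) * 2 ^ (-(-(1:ℝ)/2)) := by
          rw [← Real.rpow_add (by norm_num)]
          ring_nf
        rw [e2, e4]
        linear_combination (-(2:ℝ) ^ ((d:ℝ)/2 - 1) * 2 ^ (-(-(1:ℝ)/2))) * e3
      linear_combination ((2 * π) ^ (-(d:ℝ)/2) / π * Real.exp (y^2/2) *
        Real.Gamma (((d:ℝ) + 1) / 2) * genExpInt (((d:ℝ) + 1) / 2) (y^2/2)) * key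
    · have hm : y^2/2 ∉ Set.Iic (r^2/2) := by
        simp only [Set.mem_Iic, not_le] at *; gcongr
      simp only [hF, smul_eq_mul]
      rw [Set.indicator_of_notMem hm, Set.indicator_of_notMem (by exact hyr)]
      simp
  rw [hpt, Real.Gamma_add_one (by positivity)]
  have c1 : √π ^ d = π ^ ((d:ℝ)/2) := by
    rw [Real.sqrt_eq_rpow, ← Real.rpow_natCast, ← Real.rpow_mul pi_pos.le]
    ring_nf
  have c2 : (2 * π) ^ (-(d:ℝ)/2) = (2 ^ ((d:ℝ)/2))⁻¹ * (π ^ ((d:ℝ)/2))⁻¹ := by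
    rw [Real.mul_rpow (by norm_num) pi_pos.le, neg_div, Real.rpow_neg (by norm_num),
      Real.rpow_neg pi_pos.le]
  rw [c1, c2, Real.rpow_sub_one (by norm_num)]
  have p1 : (0:ℝ) < 2 ^ ((d:ℝ)/2) := by positivity
  have p2 : (0:ℝ) < π ^ ((d:ℝ)/2) := by positivity
  simp only [nsmul_eq_mul, smul_eq_mul]
  field_simp
end

section
/- The function F(ε) = ∫_0^ε u^{-1/2} exp(u) E_1(u) du satisfies F(ε) ∼ 2 √ε log(1/ε) as ε → 0⁺; that is, lim_{ε → 0⁺} F(ε) / (√ε · log(1/ε)) = 2. -/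
open MeasureTheory Real Filter

lemma aux_int_s14 (u : ℝ) (hu : 0 < u) :
    IntegrableOn (fun t : ℝ => Real.exp (-u * t) / t ^ (1:ℝ)) (Set.Ioi 1) := by
  have h := integrableOn_exp_mul_Ioi (a := -u) (by linarith) 1
  refine Integrable.mono' h ?_ ?_
  · apply Measurable.aestronglyMeasurable
    fun_prop
  · rw [ae_restrict_iff' measurableSet_Ioi]
    refine Eventually.of_forall fun t ht => ?_
    have ht' : (1:ℝ) < t := ht
    rw [Real.rpow_one, Real.norm_of_nonneg (by positivity)]
    exact div_le_self (by positivity) ht'.le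

lemma aux_nonneg (u : ℝ) : 0 ≤ genExpInt 1 u := by
  unfold genExpInt
  refine setIntegral_nonneg measurableSet_Ioi fun t ht => ?_
  have ht' : (1:ℝ) < t := ht
  positivity

lemma aux_split (u : ℝ) (hu : 0 < u) (hu1 : u < 1) :
    genExpInt 1 u = (∫ t in (1:ℝ)..u⁻¹, Real.exp (-u * t) / t ^ (1:ℝ)) +
      ∫ t in Set.Ioi u⁻¹, Real.exp (-u * t) / t ^ (1:ℝ) := by
  have h1 : 1 ≤ u⁻¹ := (one_le_inv₀ hu).2 hu1.le
  unfold genExpInt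
  rw [intervalIntegral.integral_of_le h1, ← Set.Ioc_union_Ioi_eq_Ioi h1]
  exact setIntegral_union Set.Ioc_disjoint_Ioi_same measurableSet_Ioi
    ((aux_int_s14 u hu).mono_set Set.Ioc_subset_Ioi_self)
    ((aux_int_s14 u hu).mono_set (Set.Ioi_subset_Ioi h1))

lemma aux_upper (u : ℝ) (hu : 0 < u) (hu1 : u < 1) : genExpInt 1 u ≤ -Real.log u + 1 := by
  have h1 : 1 ≤ u⁻¹ := (one_le_inv₀ hu).2 hu1.le
  rw [aux_split u hu hu1]
  have hi := aux_int_s14 u hu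
  apply add_le_add
  · have : ∫ t in (1:ℝ)..u⁻¹, t⁻¹ = -Real.log u := by
      rw [integral_inv_of_pos one_pos (by positivity)]; simp
    rw [← this]
    apply intervalIntegral.integral_mono_on h1
    · rw [intervalIntegrable_iff_integrableOn_Ioc_of_le h1]
      exact hi.mono_set Set.Ioc_subset_Ioi_self
    · apply intervalIntegral.intervalIntegrable_inv _ continuousOn_id
      intro x hx
      rw [Set.uIcc_of_le h1] at hx
      have := hx.1
      simp; linarith
    · intro t ht
      have : 0 < t := by linarith [ht.1]
      rw [Real.rpow_one, inv_eq_one_div]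
      gcongr
      rw [Real.exp_le_one_iff]
      nlinarith
  · have h2 : ∫ t in Set.Ioi u⁻¹, u * Real.exp (-u * t) ≤ 1 := by
      rw [integral_const_mul, integral_exp_mul_Ioi (by linarith)]
      have : u * (-Real.exp (-u * u⁻¹) / -u) = Real.exp (-1) := by field_simp
      rw [this]
      simp
    refine le_trans (setIntegral_mono_on (hi.mono_set (Set.Ioi_subset_Ioi h1))
      ((integrableOn_exp_mul_Ioi (a := -u) (by linarith) _).const_mul u) measurableSet_Ioi ?_) h2
    intro t ht
    have ht' : u⁻¹ < t := ht
    have : 0 < t := by linarith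
    rw [Real.rpow_one, div_eq_inv_mul]
    gcongr
    exact (inv_lt_of_inv_lt₀ hu ht').le

lemma aux_lower (u : ℝ) (hu : 0 < u) (hu1 : u < 1) : -Real.log u - 1 ≤ genExpInt 1 u := by
  have h1 : 1 ≤ u⁻¹ := (one_le_inv₀ hu).2 hu1.le
  rw [aux_split u hu hu1]
  have hi := aux_int_s14 u hu
  have htail : 0 ≤ ∫ t in Set.Ioi u⁻¹, Real.exp (-u * t) / t ^ (1:ℝ) := by
    refine setIntegral_nonneg measurableSet_Ioi fun t ht => ?_
    have ht' : u⁻¹ < t := ht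
    have : 0 < t := by linarith
    positivity
  have hint : IntervalIntegrable (fun t : ℝ => t⁻¹) volume 1 u⁻¹ := by
    apply intervalIntegral.intervalIntegrable_inv _ continuousOn_id
    intro x hx
    rw [Set.uIcc_of_le h1] at hx
    have := hx.1
    simp; linarith
  have h3 : ∫ t in (1:ℝ)..u⁻¹, (t⁻¹ - u) = -Real.log u - (1 - u) := by
    rw [intervalIntegral.integral_sub hint (by simp),
      integral_inv_of_pos one_pos (by positivity)]
    simp
    field_simp
  have h4 : ∫ t in (1:ℝ)..u⁻¹, (t⁻¹ - u) ≤
      ∫ t in (1:ℝ)..u⁻¹, Real.exp (-u * t) / t ^ (1:ℝ) := by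
    apply intervalIntegral.integral_mono_on h1
    · exact hint.sub (by simp)
    · rw [intervalIntegrable_iff_integrableOn_Ioc_of_le h1]
      exact hi.mono_set Set.Ioc_subset_Ioi_self
    · intro t ht
      have : 0 < t := by linarith [ht.1]
      have h5 := Real.add_one_le_exp (-u * t)
      rw [Real.rpow_one, le_div_iff₀ this, sub_mul, inv_mul_cancel₀ this.ne']
      linarith
  linarith

lemma aux_meas : Measurable (genExpInt 1) := by
  unfold genExpInt
  apply StronglyMeasurable.measurable
  apply StronglyMeasurable.integral_prod_right
    (f := fun (p : ℝ) (t : ℝ) => Real.exp (-p * t) / t ^ (1:ℝ))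
  apply Measurable.stronglyMeasurable
  unfold Function.uncurry
  fun_prop

lemma aux_rpow (u : ℝ) (hu : 0 < u) : u ^ (-(1:ℝ)/2) = (√u)⁻¹ := by
  rw [Real.sqrt_eq_rpow, ← Real.rpow_neg hu.le]; norm_num

/-- the comparison integrals -/
lemma aux_G (c ε : ℝ) (h0 : 0 < ε) (h1 : ε < 1) :
    IntervalIntegrable (fun u : ℝ => u ^ (-(1:ℝ)/2) * (-Real.log u + c)) volume 0 ε ∧
    ∫ u in (0:ℝ)..ε, u ^ (-(1:ℝ)/2) * (-Real.log u + c) =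
      √ε * (2 * Real.log (1/ε) + 4 + 2 * c) := by
  have hder : ∀ c : ℝ, ∀ u ∈ Set.Ioo 0 ε, HasDerivAt
      (fun u : ℝ => -4 * (√u * Real.log √u) + (4 + 2 * c) * √u)
      (u ^ (-(1:ℝ)/2) * (-Real.log u + c)) u := by
    intro c u hu
    have hs : 0 < √u := Real.sqrt_pos.2 hu.1
    have hd := Real.hasDerivAt_sqrt hu.1.ne'
    have := (((Real.hasDerivAt_mul_log hs.ne').comp u hd).const_mul (-4)).add
      (hd.const_mul (4 + 2 * c))
    refine this.congr_deriv ?_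
    rw [aux_rpow u hu.1, Real.log_sqrt hu.1.le]
    field_simp
    ring
  have hcont : ∀ c : ℝ, Continuous
      (fun u : ℝ => -4 * (√u * Real.log √u) + (4 + 2 * c) * √u) := by
    intro c
    have := Real.continuous_mul_log.comp Real.continuous_sqrt
    exact (this.const_mul (-4)).add (Real.continuous_sqrt.const_mul _)
  have hI0 : IntervalIntegrable (fun u : ℝ => u ^ (-(1:ℝ)/2) * (-Real.log u + 0)) volume 0 ε := by
    rw [intervalIntegrable_iff_integrableOn_Ioc_of_le h0.le]
    refine intervalIntegral.integrableOn_deriv_of_nonneg (hcont 0).continuousOn (hder 0) ?_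
    intro u hu
    have := Real.log_nonpos hu.1.le (hu.2.trans h1).le
    have h3 : 0 ≤ u ^ (-(1:ℝ)/2) := Real.rpow_nonneg hu.1.le _
    exact mul_nonneg h3 (by linarith)
  have hI1 : IntervalIntegrable (fun u : ℝ => u ^ (-(1:ℝ)/2)) volume 0 ε :=
    intervalIntegral.intervalIntegrable_rpow' (by norm_num)
  have hI : IntervalIntegrable (fun u : ℝ => u ^ (-(1:ℝ)/2) * (-Real.log u + c)) volume 0 ε := by
    refine (hI0.add (hI1.mul_const c)).congr ?_
    intro u _
    simp
    ring
  refine ⟨hI, ?_⟩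
  rw [intervalIntegral.integral_eq_sub_of_hasDerivAt_of_le h0.le (hcont c).continuousOn (hder c) hI]
  rw [Real.log_sqrt h0.le]
  simp
  ring

lemma aux_bounds (ε : ℝ) (h0 : 0 < ε) (h1 : ε < 1) :
    √ε * (2 * Real.log (1/ε) + 2) ≤
      ∫ u in (0:ℝ)..ε, u ^ (-(1:ℝ)/2) * Real.exp u * genExpInt 1 u ∧
    ∫ u in (0:ℝ)..ε, u ^ (-(1:ℝ)/2) * Real.exp u * genExpInt 1 u ≤
      Real.exp ε * (√ε * (2 * Real.log (1/ε) + 6)) := by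
  obtain ⟨l1, l2⟩ := aux_G (-1) ε h0 h1
  obtain ⟨u1, u2⟩ := aux_G 1 ε h0 h1
  have hup : ∀ u ∈ Set.Ioc 0 ε, u ^ (-(1:ℝ)/2) * Real.exp u * genExpInt 1 u ≤
      Real.exp ε * (u ^ (-(1:ℝ)/2) * (-Real.log u + 1)) := by
    intro u hu
    have h3 : 0 ≤ u ^ (-(1:ℝ)/2) := Real.rpow_nonneg hu.1.le _
    have h4 := aux_upper u hu.1 (hu.2.trans_lt h1)
    have h5 := aux_nonneg u
    calc _ = u ^ (-(1:ℝ)/2) * (Real.exp u * genExpInt 1 u) := by ring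
      _ ≤ u ^ (-(1:ℝ)/2) * (Real.exp ε * (-Real.log u + 1)) := by
        gcongr
        exact hu.2
      _ = _ := by ring
  have hlo : ∀ u ∈ Set.Ioc 0 ε, u ^ (-(1:ℝ)/2) * (-Real.log u + -1) ≤
      u ^ (-(1:ℝ)/2) * Real.exp u * genExpInt 1 u := by
    intro u hu
    have h3 : 0 ≤ u ^ (-(1:ℝ)/2) := Real.rpow_nonneg hu.1.le _
    have h4 := aux_lower u hu.1 (hu.2.trans_lt h1)
    have h5 := aux_nonneg u
    have h6 := Real.one_le_exp hu.1.le
    rw [mul_assoc]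
    gcongr
    nlinarith
  have u1' := u1.const_mul (Real.exp ε)
  have hI : IntervalIntegrable (fun u : ℝ => u ^ (-(1:ℝ)/2) * Real.exp u * genExpInt 1 u)
      volume 0 ε := by
    rw [intervalIntegrable_iff_integrableOn_Ioc_of_le h0.le] at u1' ⊢
    refine Integrable.mono' u1' ?_ ?_
    · apply Measurable.aestronglyMeasurable
      have := aux_meas
      fun_prop
    · rw [ae_restrict_iff' measurableSet_Ioc]
      refine Eventually.of_forall fun u hu => ?_
      have h3 : 0 ≤ u ^ (-(1:ℝ)/2) := Real.rpow_nonneg hu.1.le _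
      have h5 := aux_nonneg u
      rw [Real.norm_of_nonneg (by positivity)]
      exact hup u hu
  constructor
  · have := intervalIntegral.integral_mono_on_of_le_Ioo h0.le l1 hI
      (fun u hu => hlo u ⟨hu.1, hu.2.le⟩)
    rw [l2] at this
    refine le_trans (le_of_eq ?_) this
    ring
  · have := intervalIntegral.integral_mono_on_of_le_Ioo h0.le hI u1'
      (fun u hu => hup u ⟨hu.1, hu.2.le⟩)
    rw [intervalIntegral.integral_const_mul, u2] at this
    refine le_trans this (le_of_eq ?_)
    ring

theorem small_eps_asymptotics_d_one :
    Tendsto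
      (fun ε : ℝ =>
        (∫ u in (0:ℝ)..ε, u ^ (-(1:ℝ)/2) * Real.exp u * genExpInt 1 u) /
          (Real.sqrt ε * Real.log (1 / ε)))
      (nhdsWithin 0 (Set.Ioi 0)) (nhds 2) := by
  have hL : Tendsto (fun ε : ℝ => (Real.log (1/ε))⁻¹) (nhdsWithin 0 (Set.Ioi 0)) (nhds 0) := by
    apply tendsto_inv_atTop_zero.comp
    simp only [one_div]
    exact Real.tendsto_log_atTop.comp tendsto_inv_nhdsGT_zero
  have he : Tendsto (fun ε : ℝ => Real.exp ε) (nhdsWithin 0 (Set.Ioi 0)) (nhds 1) := by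
    have := Real.continuous_exp.tendsto 0
    rw [Real.exp_zero] at this
    exact this.mono_left nhdsWithin_le_nhds
  have hlow : Tendsto (fun ε : ℝ => 2 + 2 * (Real.log (1/ε))⁻¹)
      (nhdsWithin 0 (Set.Ioi 0)) (nhds 2) := by
    simpa using (hL.const_mul 2).const_add 2
  have hupp : Tendsto (fun ε : ℝ => Real.exp ε * (2 + 6 * (Real.log (1/ε))⁻¹))
      (nhdsWithin 0 (Set.Ioi 0)) (nhds 2) := by
    simpa using he.mul ((hL.const_mul 6).const_add 2)
  have hev : ∀ᶠ ε : ℝ in nhdsWithin 0 (Set.Ioi 0), ε ∈ Set.Ioo (0:ℝ) 1 :=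
    Ioo_mem_nhdsGT one_pos
  refine tendsto_of_tendsto_of_tendsto_of_le_of_le' hlow hupp ?_ ?_
  · filter_upwards [hev] with ε hε
    have hs : 0 < √ε := Real.sqrt_pos.2 hε.1
    have hl : 0 < Real.log (1/ε) := Real.log_pos ((one_lt_div hε.1).2 hε.2)
    rw [le_div_iff₀ (by positivity)]
    refine le_trans (le_of_eq ?_) (aux_bounds ε hε.1 hε.2).1
    field_simp
  · filter_upwards [hev] with ε hε
    have hs : 0 < √ε := Real.sqrt_pos.2 hε.1
    have hl : 0 < Real.log (1/ε) := Real.log_pos ((one_lt_div hε.1).2 hε.2)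
    rw [div_le_iff₀ (by positivity)]
    refine le_trans (aux_bounds ε hε.1 hε.2).2 (le_of_eq ?_)
    field_simp
end

section
/- For d = 1, the Grouped (ordinary) Horseshoe prior mass of a shrinking interval about the origin satisfies lim_{r → 0⁺} [∫_{-r}^{r} p_{HS,1}(θ) dθ] / (r · log(1/r)) = 2√2 / π^{3/2}. -/
open MeasureTheory Real Filter

/-- The (ordinary, d = 1) Horseshoe density on `ℝ`. -/
noncomputable def pHS1 (x : ℝ) : ℝ :=
  ∫ l in Set.Ioi (0:ℝ),
    (2 * π * l ^ 2) ^ (-(1:ℝ)/2) * Real.exp (-x^2 / (2 * l ^ 2)) *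
      (2 / (π * (1 + l ^ 2)))

noncomputable def hsG (x l : ℝ) : ℝ := l⁻¹ * Real.exp (-x^2 / (2 * l ^ 2)) / (1 + l ^ 2)

noncomputable def hsC : ℝ := 2 / (π * Real.sqrt (2 * π))

lemma hsC_pos : 0 < hsC := by unfold hsC; positivity

lemma pHS1_eq (x : ℝ) : pHS1 x = hsC * ∫ l in Set.Ioi (0:ℝ), hsG x l := by
  unfold pHS1
  rw [← integral_const_mul]
  refine setIntegral_congr_fun measurableSet_Ioi ?_
  intro l hl
  have hl : 0 < l := hl
  have h1 : (2 * π * l ^ 2) ^ (-(1:ℝ)/2) = (Real.sqrt (2 * π) * l)⁻¹ := by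
    rw [neg_div, Real.rpow_neg (by positivity), ← Real.sqrt_eq_rpow,
      Real.sqrt_mul (by positivity), Real.sqrt_sq hl.le]
  simp only [h1, hsG, hsC]
  have : Real.sqrt (2 * π) ≠ 0 := by positivity
  have := pi_ne_zero
  field_simp

lemma hsG_meas : Measurable (Function.uncurry hsG) := by
  unfold hsG Function.uncurry
  fun_prop

lemma hsG_nonneg (x l : ℝ) (hl : 0 < l) : 0 ≤ hsG x l := by
  unfold hsG; positivity

lemma hsG_le_inv (x l : ℝ) (hl : 0 < l) : hsG x l ≤ l⁻¹ := by
  unfold hsG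
  have : Real.exp (-x^2 / (2 * l ^ 2)) ≤ 1 := by
    apply Real.exp_le_one_iff.2
    apply div_nonpos_of_nonpos_of_nonneg
    · nlinarith [sq_nonneg x]
    · positivity
  rw [div_le_iff₀ (by positivity)]
  have h2 : 0 ≤ l⁻¹ := by positivity
  apply mul_le_mul_of_nonneg_left _ h2
  nlinarith [sq_nonneg l]

lemma hsG_le_one (x l : ℝ) (hx : 0 < x) (hl : 0 < l) : hsG x l ≤ 2 / x^2 * l := by
  unfold hsG
  have h : Real.exp (-x^2 / (2 * l ^ 2)) ≤ 2 * l^2 / x^2 := by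
    have := Real.add_one_le_exp (x^2 / (2*l^2))
    rw [neg_div, Real.exp_neg, inv_le_comm₀ (by positivity) (by positivity), inv_div]
    linarith
  rw [div_le_iff₀ (by positivity)]
  calc l⁻¹ * Real.exp (-x^2 / (2 * l ^ 2)) ≤ l⁻¹ * (2 * l^2 / x^2) := by gcongr
    _ = 2 / x^2 * l * 1 := by field_simp
    _ ≤ _ := by gcongr; nlinarith [sq_nonneg l]

lemma hsG_le_two (x l : ℝ) (hl : 1 < l) : hsG x l ≤ l ^ (-2:ℝ) := by
  have hl0 : 0 < l := by linarith
  unfold hsG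
  have : Real.exp (-x^2 / (2 * l ^ 2)) ≤ 1 := by
    apply Real.exp_le_one_iff.2
    apply div_nonpos_of_nonpos_of_nonneg
    · nlinarith [sq_nonneg x]
    · positivity
  rw [Real.rpow_neg hl0.le, Real.rpow_two, div_le_iff₀ (by positivity)]
  have h2 : l⁻¹ ≤ 1 := inv_le_one_of_one_le₀ hl.le
  have h3 : (l^2)⁻¹ * (1 + l^2) = (l^2)⁻¹ + 1 := by field_simp
  rw [h3]
  have h4 : 0 ≤ (l^2)⁻¹ := by positivity
  have h5 : 0 ≤ l⁻¹ := by positivity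
  nlinarith [mul_le_mul_of_nonneg_left this h5]

lemma hsG_ge (x l : ℝ) (hl : 0 < l) (hxl : 0 ≤ x) :
    l⁻¹ - x^2/2 * l ^ (-3:ℝ) - l ≤ hsG x l := by
  have e3 : l ^ (-3:ℝ) = (l^3)⁻¹ := by
    rw [Real.rpow_neg hl.le]; norm_cast
  rw [e3]
  unfold hsG
  have h := Real.add_one_le_exp (-x^2 / (2*l^2))
  set E := Real.exp (-x^2 / (2*l^2)) with hE
  have hE1 : E ≤ 1 := by
    apply Real.exp_le_one_iff.2
    apply div_nonpos_of_nonpos_of_nonneg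
    · nlinarith [sq_nonneg x]
    · positivity
  have hE0 : 0 < E := Real.exp_pos _
  have h1 : E - l^2 ≤ E / (1 + l^2) := by
    rw [le_div_iff₀ (by positivity)]
    nlinarith [sq_nonneg (l^2), sq_nonneg l, mul_le_mul_of_nonneg_right hE1 (sq_nonneg l)]
  have h2 : l⁻¹ * (-x^2 / (2*l^2) + 1 - l^2) ≤ l⁻¹ * (E / (1+l^2)) := by
    gcongr; linarith
  calc _ = l⁻¹ * (-x^2 / (2*l^2) + 1 - l^2) := by field_simp; ring
    _ ≤ _ := h2
    _ = _ := by ring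

lemma hsG_meas_r (x : ℝ) : Measurable (hsG x) := by
  unfold hsG; fun_prop

lemma hsJ_bound (x : ℝ) (hx : 0 < x) (hx1 : x < 1) :
    |(∫ l in Set.Ioi (0:ℝ), hsG x l) + Real.log x| ≤ 2 := by
  have i1' : IntegrableOn (fun l => 2 / x^2 * l) (Set.Ioc 0 x) := by
    apply Continuous.integrableOn_Ioc; fun_prop
  have i1 : IntegrableOn (hsG x) (Set.Ioc 0 x) := by
    refine Integrable.mono' i1' (hsG_meas_r x).aestronglyMeasurable ?_
    refine (ae_restrict_iff' measurableSet_Ioc).2 (ae_of_all _ fun l hl => ?_)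
    rw [Real.norm_of_nonneg (hsG_nonneg x l hl.1)]
    exact hsG_le_one x l hx hl.1
  have n0 : (0:ℝ) ∉ Set.uIcc x 1 := by
    rw [Set.uIcc_of_le hx1.le]; intro h; linarith [h.1]
  have i2v : IntervalIntegrable (fun l : ℝ => l⁻¹) volume x 1 :=
    intervalIntegrable_inv_iff.2 (Or.inr n0)
  have i2' : IntegrableOn (fun l : ℝ => l⁻¹) (Set.Ioc x 1) :=
    (intervalIntegrable_iff_integrableOn_Ioc_of_le hx1.le).1 i2v
  have i2 : IntegrableOn (hsG x) (Set.Ioc x 1) := by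
    refine Integrable.mono' i2' (hsG_meas_r x).aestronglyMeasurable ?_
    refine (ae_restrict_iff' measurableSet_Ioc).2 (ae_of_all _ fun l hl => ?_)
    have : 0 < l := hx.trans hl.1
    rw [Real.norm_of_nonneg (hsG_nonneg x l this)]
    exact hsG_le_inv x l this
  have i3' : IntegrableOn (fun l : ℝ => l ^ (-2:ℝ)) (Set.Ioi 1) :=
    integrableOn_Ioi_rpow_of_lt (by norm_num) one_pos
  have i3 : IntegrableOn (hsG x) (Set.Ioi 1) := by
    refine Integrable.mono' i3' (hsG_meas_r x).aestronglyMeasurable ?_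
    refine (ae_restrict_iff' measurableSet_Ioi).2 (ae_of_all _ fun l hl => ?_)
    have hl : 1 < l := hl
    rw [Real.norm_of_nonneg (hsG_nonneg x l (by linarith))]
    exact hsG_le_two x l hl
  have s1 : Set.Ioc 0 x ∪ (Set.Ioc x 1 ∪ Set.Ioi 1) = Set.Ioi (0:ℝ) := by
    rw [Set.Ioc_union_Ioi_eq_Ioi hx1.le, Set.Ioc_union_Ioi_eq_Ioi hx.le]
  have d1 : Disjoint (Set.Ioc 0 x) (Set.Ioc x 1 ∪ Set.Ioi 1) := by
    rw [Set.Ioc_union_Ioi_eq_Ioi hx1.le]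
    exact Set.Ioc_disjoint_Ioi_same
  have d2 : Disjoint (Set.Ioc x 1) (Set.Ioi 1) := Set.Ioc_disjoint_Ioi_same
  rw [← s1, setIntegral_union d1 (measurableSet_Ioc.union measurableSet_Ioi) i1 (i2.union i3),
    setIntegral_union d2 measurableSet_Ioi i2 i3]
  have b1 : ∫ l in Set.Ioc 0 x, hsG x l ≤ 1 := by
    calc _ ≤ ∫ l in Set.Ioc 0 x, 2 / x^2 * l :=
          setIntegral_mono_on i1 i1' measurableSet_Ioc fun l hl => hsG_le_one x l hx hl.1
      _ = 1 := by
        rw [← intervalIntegral.integral_of_le hx.le, intervalIntegral.integral_const_mul,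
          integral_id]
        field_simp; ring
  have b1' : 0 ≤ ∫ l in Set.Ioc 0 x, hsG x l :=
    setIntegral_nonneg measurableSet_Ioc fun l hl => hsG_nonneg x l hl.1
  have b3 : ∫ l in Set.Ioi 1, hsG x l ≤ 1 := by
    calc _ ≤ ∫ l in Set.Ioi 1, (l:ℝ) ^ (-2:ℝ) :=
          setIntegral_mono_on i3 i3' measurableSet_Ioi fun l hl => hsG_le_two x l hl
      _ = 1 := by
        rw [integral_Ioi_rpow_of_lt (by norm_num) one_pos]; norm_num
  have b3' : 0 ≤ ∫ l in Set.Ioi 1, hsG x l :=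
    setIntegral_nonneg measurableSet_Ioi fun l (hl : 1 < l) => hsG_nonneg x l (by linarith)
  have b2 : ∫ l in Set.Ioc x 1, hsG x l ≤ - Real.log x := by
    calc _ ≤ ∫ l in Set.Ioc x 1, (l:ℝ)⁻¹ :=
          setIntegral_mono_on i2 i2' measurableSet_Ioc
            fun l hl => hsG_le_inv x l (hx.trans hl.1)
      _ = _ := by
        rw [← intervalIntegral.integral_of_le hx1.le, integral_inv n0]
        simp
  have j3 : IntervalIntegrable (fun l : ℝ => x^2/2 * l ^ (-3:ℝ)) volume x 1 :=
    (intervalIntegral.intervalIntegrable_rpow (Or.inr n0)).const_mul _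
  have jid : IntervalIntegrable (fun l : ℝ => l) volume x 1 :=
    continuous_id.intervalIntegrable _ _
  have b2' : - Real.log x - 1 ≤ ∫ l in Set.Ioc x 1, hsG x l := by
    calc _ ≤ ∫ l in x..1, (l⁻¹ - x^2/2 * l ^ (-3:ℝ) - l) := by
          rw [intervalIntegral.integral_sub (i2v.sub j3) jid,
            intervalIntegral.integral_sub i2v j3, integral_inv n0,
            intervalIntegral.integral_const_mul, integral_rpow (Or.inr ⟨by norm_num, n0⟩),
            integral_id]
          have e : x ^ (-3 + 1 : ℝ) = (x^2)⁻¹ := by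
            rw [show (-3 + 1 : ℝ) = -2 by norm_num, Real.rpow_neg hx.le, Real.rpow_two]
          rw [e]
          have e2 : x^2/2 * ((1 ^ (-3 + 1 : ℝ) - (x^2)⁻¹) / (-3 + 1)) = (1 - x^2)/4 := by
            rw [Real.one_rpow]; field_simp; ring
          rw [e2]
          simp only [one_div, Real.log_inv]
          nlinarith [sq_nonneg x]
      _ ≤ _ := by
          rw [intervalIntegral.integral_of_le hx1.le]
          exact setIntegral_mono_on ((intervalIntegrable_iff_integrableOn_Ioc_of_le hx1.le).1
            ((i2v.sub j3).sub jid)) i2 measurableSet_Ioc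
            fun l hl => hsG_ge x l (hx.trans hl.1) hx.le
  rw [abs_le]
  constructor <;> linarith

lemma hsJ_zero : ∫ l in Set.Ioi (0:ℝ), hsG 0 l = 0 := by
  apply integral_undef
  intro h
  have h1 : IntegrableOn (fun l => 2 * hsG 0 l) (Set.Ioc 0 1) :=
    (h.mono_measure (Measure.restrict_mono Set.Ioc_subset_Ioi_self le_rfl)).const_mul 2
  have h2 : IntegrableOn (fun l : ℝ => l⁻¹) (Set.Ioc 0 1) := by
    refine Integrable.mono' h1 measurable_inv.aestronglyMeasurable ?_
    refine (ae_restrict_iff' measurableSet_Ioc).2 (ae_of_all _ fun l hl => ?_)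
    have h0 : 0 < l := hl.1
    rw [Real.norm_of_nonneg (by positivity)]
    simp only [hsG]
    rw [show -(0:ℝ)^2 / (2 * l^2) = 0 by simp, Real.exp_zero, mul_one, ← mul_div_assoc,
      le_div_iff₀ (by positivity), mul_comm]
    gcongr
    nlinarith [hl.2]
  have h3 := (intervalIntegrable_iff_integrableOn_Ioc_of_le zero_le_one).2 h2
  rcases intervalIntegrable_inv_iff.1 h3 with h | h
  · norm_num at h
  · exact h (by simp)

lemma pHS1_bound (x : ℝ) (hx : |x| < 1) : |pHS1 x + hsC * Real.log x| ≤ hsC * 2 := by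
  rw [pHS1_eq, ← mul_add, abs_mul, abs_of_pos hsC_pos]
  refine mul_le_mul_of_nonneg_left ?_ hsC_pos.le
  by_cases h0 : x = 0
  · subst h0; rw [hsJ_zero]; simp
  · have := hsJ_bound |x| (abs_pos.2 h0) hx
    rw [Real.log_abs] at this
    have e : hsG |x| = hsG x := by
      funext l; simp [hsG]
    rwa [e] at this

lemma pHS1_meas : Measurable pHS1 := by
  have e : pHS1 = fun x => hsC * ∫ l in Set.Ioi (0:ℝ), hsG x l := funext pHS1_eq
  rw [e]
  have := (hsG_meas.stronglyMeasurable).integral_prod_right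
    (ν := (volume.restrict (Set.Ioi (0:ℝ))))
  exact this.measurable.const_mul _

lemma mass_bound (r : ℝ) (hr : 0 < r) (hr1 : r < 1) :
    |(∫ θ in (-r)..r, pHS1 θ) + hsC * (2 * (r * Real.log r) - 2 * r)| ≤ hsC * 4 * r := by
  have il : IntervalIntegrable (fun x => hsC * Real.log x) volume (-r) r :=
    intervalIntegral.intervalIntegrable_log'.const_mul _
  have hb : ∀ x ∈ Set.uIoc (-r) r, ‖pHS1 x + hsC * Real.log x‖ ≤ hsC * 2 := by
    intro x hx
    rw [Set.uIoc_of_le (by linarith)] at hx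
    exact pHS1_bound x (abs_lt.2 ⟨by linarith [hx.1], by linarith [hx.2]⟩)
  have is : IntervalIntegrable (fun x => pHS1 x + hsC * Real.log x) volume (-r) r := by
    refine IntervalIntegrable.mono_fun' (intervalIntegrable_const (c := hsC * 2)) ?_ ?_
    · exact (pHS1_meas.add (Real.measurable_log.const_mul _)).aestronglyMeasurable
    · exact (ae_restrict_iff' measurableSet_uIoc).2 (ae_of_all _ hb)
  have ip : IntervalIntegrable pHS1 volume (-r) r := by
    have := is.sub il
    simpa using this
  have h := intervalIntegral.norm_integral_le_of_norm_le_const hb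
  rw [intervalIntegral.integral_add ip il, intervalIntegral.integral_const_mul, integral_log,
    Real.log_neg_eq_log, abs_of_pos (by linarith), Real.norm_eq_abs] at h
  calc _ = _ := by congr 2; ring
    _ ≤ _ := h
    _ = _ := by ring

theorem horseshoe_interval_mass_asymptotics :
    Tendsto
      (fun r : ℝ => (∫ θ in (-r)..r, pHS1 θ) / (r * Real.log (1 / r)))
      (nhdsWithin 0 (Set.Ioi 0))
      (nhds (2 * Real.sqrt 2 / π ^ ((3:ℝ)/2))) := by
  have hc : 2 * Real.sqrt 2 / π ^ ((3:ℝ)/2) = 2 * hsC := by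
    have h2 : Real.sqrt 2 * Real.sqrt 2 = 2 := Real.mul_self_sqrt (by norm_num)
    have hp : π ^ ((3:ℝ)/2) = π * Real.sqrt π := by
      rw [show (3:ℝ)/2 = 1 + 1/2 by norm_num, Real.rpow_add pi_pos, Real.rpow_one,
        Real.sqrt_eq_rpow]
    rw [hp, hsC, Real.sqrt_mul (by norm_num)]
    have : Real.sqrt π ≠ 0 := by positivity
    have : Real.sqrt 2 ≠ 0 := by positivity
    field_simp
    nlinarith
  rw [hc, tendsto_iff_dist_tendsto_zero]
  have hlog : Tendsto (fun r : ℝ => hsC * 6 / Real.log (1 / r)) (nhdsWithin 0 (Set.Ioi 0))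
      (nhds 0) := by
    apply Tendsto.const_div_atTop
    simp only [one_div]
    exact Real.tendsto_log_atTop.comp tendsto_inv_nhdsGT_zero
  refine squeeze_zero' (Eventually.of_forall fun _ => dist_nonneg) ?_ hlog
  filter_upwards [Ioo_mem_nhdsGT (zero_lt_one' ℝ)] with r hr
  obtain ⟨hr0, hr1⟩ := hr
  have hm := mass_bound r hr0 hr1
  have hL : 0 < Real.log (1 / r) := Real.log_pos (by rw [lt_div_iff₀ hr0]; linarith)
  have hLe : Real.log r = - Real.log (1 / r) := by simp
  rw [hLe] at hm
  set L := Real.log (1 / r)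
  set I := ∫ θ in (-r)..r, pHS1 θ
  have e : I / (r * L) - 2 * hsC = (I - 2 * hsC * (r * L)) / (r * L) := by
    field_simp
  rw [Real.dist_eq, e, abs_div, abs_of_pos (mul_pos hr0 hL), div_le_div_iff₀ (by positivity) hL]
  have : |I - 2 * hsC * (r * L)| ≤ hsC * 6 * r := by
    have hcr := mul_pos hsC_pos hr0
    rw [abs_le] at hm ⊢
    constructor <;> nlinarith [hm.1, hm.2]
  calc _ ≤ hsC * 6 * r * L := by gcongr
    _ = _ := by ring
end
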